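/- arXiv:1904.09263 — 4 statements merged into one kernel-verified Lean document; each statement's English description precedes it below -/
import Mathlib

section
/- Let k be a flexible field and let E be a finitely generated field extension of k. Then E is itself a flexible field. -/
universe u

/-- A witness that the field `k` is flexible: a field `k₀` together with an isomorphism of `k`
with the purely transcendental extension `k₀(t₁,t₂,…)` of countably infinite degree, i.e. with
the field of rational functions over `k₀` in variables indexed by `ℕ`. -/
structure FlexibleWitness (k : Type u) [Field k] : Type (u + 1) where
  /-- the base field -/
  base : Type u
  [fieldBase : Field base]
  /-- the isomorphism of `k` with `base(t₁,t₂,…)` -/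
  equiv : k ≃+* FractionRing (MvPolynomial ℕ base)

/-- A field `k` is flexible if it is a purely transcendental extension of countably infinite
transcendence degree of some field. -/
def IsFlexible (k : Type u) [Field k] : Prop :=
  Nonempty (FlexibleWitness k)

open IntermediateField in
/-- A field generated over a subfield by an infinite countable transcendence basis together with
a finite set is flexible. -/
theorem isFlexible_of_isTranscendenceBasis {F E : Type u} [Field F] [Field E] [Algebra F E]
    {B S : Set E} (hB : IsTranscendenceBasis F ((↑) : B → E)) (hcount : B.Countable)
    (hinf : B.Infinite) (hS : S.Finite) (htop : adjoin F (B ∪ S) = ⊤) : IsFlexible E := by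
  have hsub : S ⊆ (AlgebraicIndependent.matroid F E).closure B := by
    rw [(AlgebraicIndependent.matroid_isBase_iff.mpr hB).closure_eq]
    exact Set.subset_univ S
  obtain ⟨T, hTB, hTfin, -, hST⟩ :=
    Matroid.exists_subset_finite_closure_of_subset_closure hS hsub
  let K := adjoin F T
  let L := adjoin K S
  have hL : Algebra.IsAlgebraic K L := by
    refine isAlgebraic_adjoin fun x hx ↦ ?_
    have h := hST hx
    rw [AlgebraicIndependent.matroid_closure_eq, SetLike.mem_coe,
      Subalgebra.mem_algebraicClosure] at h
    exact (isAlgebraic_adjoin_iff.mpr h).isIntegral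
  have hind : AlgebraicIndependent L ((↑) : ↥(B \ T) → E) := by
    have h : AlgebraicIndependent K ((↑) : ↥(B \ T) → E) := by
      rw [algebraicIndependent_adjoin_iff]
      have h' := hB.1.adjoin_of_disjoint (s := (↑) ⁻¹' T) (t := ((↑) ⁻¹' T)ᶜ)
        disjoint_compl_right
      rw [Subtype.image_preimage_coe, Set.inter_eq_right.mpr hTB] at h'
      exact h'.comp (fun x : ↥(B \ T) ↦ ⟨⟨x, x.2.1⟩, x.2.2⟩) fun x y hxy ↦ by
        simpa [Subtype.ext_iff] using hxy
    exact h.extendScalars L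
  have htop' : adjoin L (Set.range ((↑) : ↥(B \ T) → E)) = ⊤ := by
    rw [Subtype.range_coe, ← restrictScalars_eq_top_iff (K := K), adjoin_adjoin_left,
      ← restrictScalars_eq_top_iff (K := F), adjoin_adjoin_left, eq_top_iff, ← htop]
    refine adjoin.mono _ _ _ fun x hx ↦ ?_
    by_cases hxT : x ∈ T <;> simp_all [or_comm]
  have : Infinite ↥(B \ T) := (hinf.sdiff hTfin).to_subtype
  have : Countable ↥(B \ T) := (hcount.mono Set.sdiff_subset).to_subtype
  obtain ⟨e⟩ : Nonempty (ℕ ≃ ↥(B \ T)) := nonempty_equiv_of_countable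
  have hind' := hind.comp e e.injective
  have htop'' : adjoin L (Set.range ((↑) ∘ e : ℕ → E)) = ⊤ := by
    rw [e.surjective.range_comp, htop']
  exact ⟨⟨L, (topEquiv.symm.trans ((equivOfEq htop''.symm).trans
    hind'.aevalEquivField.symm)).toRingEquiv⟩⟩

/-- Any finitely generated field extension of a flexible field is flexible. -/
theorem finitelyGenerated_extension_of_flexible_isFlexible
    {k E : Type u} [Field k] [Field E] [Algebra k E]
    (hk : IsFlexible k) (hfg : (⊤ : IntermediateField k E).FG) :
    IsFlexible E := by
  obtain ⟨F, e⟩ := hk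
  obtain ⟨S, hS⟩ := hfg
  let f : FractionRing (MvPolynomial ℕ F) →+* E := (algebraMap k E).comp e.symm.toRingHom
  let _ : Algebra F E := (f.comp (algebraMap F _)).toAlgebra
  let φ : FractionRing (MvPolynomial ℕ F) →ₐ[F] E := { f with commutes' := fun _ ↦ rfl }
  let X : ℕ → FractionRing (MvPolynomial ℕ F) := fun i ↦ algebraMap (MvPolynomial ℕ F) _ (MvPolynomial.X i)
  let t : ℕ → E := φ ∘ X
  have ht : AlgebraicIndependent F t :=
    ((MvPolynomial.algebraicIndependent_X ℕ F).map' (f := IsScalarTower.toAlgHom F _ _)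
      (IsFractionRing.injective _ (FractionRing (MvPolynomial ℕ F)))).map' (f := φ) φ.injective
  have hrange : φ.fieldRange = IntermediateField.adjoin F (Set.range t) :=
    IsFractionRing.algHom_fieldRange_eq_of_comp_eq_of_range_eq (g := MvPolynomial.aeval t)
      (MvPolynomial.ringHom_ext (fun _ ↦ by simp [← MvPolynomial.algebraMap_eq]; rfl)
        fun _ ↦ by simp [t, X])
      (Algebra.adjoin_range_eq_range_aeval F t).symm
  have htop : IntermediateField.adjoin F (Set.range t ∪ S) = ⊤ := by
    let M : IntermediateField k E :=
      { (IntermediateField.adjoin F (Set.range t ∪ S)).toSubfield with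
        algebraMap_mem' := fun x ↦ by
          have h : algebraMap k E x ∈ φ.fieldRange := ⟨e x, by simp [φ, f]⟩
          rw [hrange] at h
          exact IntermediateField.adjoin.mono _ _ _ Set.subset_union_left h }
    have hM : M = ⊤ := by
      rw [eq_top_iff, ← hS, IntermediateField.adjoin_le_iff]
      exact fun x hx ↦ IntermediateField.subset_adjoin F _ (Or.inr hx)
    rw [eq_top_iff]
    intro x _
    have h : x ∈ M := hM ▸ IntermediateField.mem_top
    exact h
  have : Algebra.IsAlgebraic (Algebra.adjoin F (Set.range t ∪ S)) E := by
    rw [← IntermediateField.isAlgebraic_adjoin_iff_top, htop]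
    exact ⟨fun x ↦ isAlgebraic_algebraMap (⟨x, IntermediateField.mem_top⟩ :
      (⊤ : IntermediateField F E))⟩
  obtain ⟨B, htB, hBS, hB⟩ :=
    exists_isTranscendenceBasis_between (R := F) _ _ (Set.subset_union_left (t := (S : Set E)))
      ht.coe_range
  refine isFlexible_of_isTranscendenceBasis hB
    (((Set.countable_range t).union S.countable_toSet).mono hBS)
    ((Set.infinite_range_of_injective ht.injective).mono htB) S.finite_toSet ?_
  rw [eq_top_iff, ← htop]
  exact IntermediateField.adjoin.mono _ _ _ (Set.union_subset_union_left _ htB)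
end

section
/- Let k₀ be a field and k = k₀(t₁,t₂,…) the purely transcendental extension of k₀ of countably infinite degree (the fraction field of the polynomial ring over k₀ in variables t₁,t₂,…). Then for every finitely generated field extension E of k there exist a natural number N and a field E₀, finitely generated as a field extension of k₀, such that E is isomorphic to a purely transcendental extension of E₀ with transcendence basis {t_N, t_{N+1}, t_{N+2}, …}; that is, E ≅ E₀(t_N, t_{N+1}, …). -/
universe u

/-- A presentation of the field `E` as a purely transcendental extension of a field `E₀`
finitely generated over `k₀`, with transcendence basis the elements `t n` for `n ≥ N`. -/
structure PTPresentation (k₀ E : Type u) [Field k₀] [Field E] (t : ℕ → E) (N : ℕ) :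
    Type (u+1) where
  /-- the field of definition -/
  E₀ : Type u
  [fieldE₀ : Field E₀]
  /-- the structure embedding of `k₀` into `E₀` -/
  emb : k₀ →+* E₀
  /-- `E₀` is finitely generated as a field extension of `k₀` -/
  fg : ∃ s : Finset E₀, Subfield.closure (Set.range emb ∪ ↑s) = ⊤
  /-- `E` is isomorphic to the purely transcendental extension `E₀(t_N, t_{N+1}, …)` -/
  iso : E ≃+* FractionRing (MvPolynomial {n : ℕ // N ≤ n} E₀)
  /-- the isomorphism matches `t n` with the variable of the same index, for `n ≥ N` -/
  iso_t : ∀ (n : ℕ) (h : N ≤ n), iso (t n) =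
    algebraMap (MvPolynomial {n : ℕ // N ≤ n} E₀)
      (FractionRing (MvPolynomial {n : ℕ // N ≤ n} E₀)) (MvPolynomial.X ⟨n, h⟩)

open IntermediateField in
/-- If a field `E` is generated over `k` by an algebraically independent sequence `t` together with
a finite set `s`, then for some finite set `S`, a tail of `t` is algebraically
independent over `k(S)` and generates `E` over it. -/
theorem exists_finite_tail_algebraicIndependent {k E : Type*} [Field k] [Field E] [Algebra k E]
    {t : ℕ → E} (ht : AlgebraicIndependent k t) {s : Set E} (hs : s.Finite)
    (htop : adjoin k (Set.range t ∪ s) = ⊤) :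
    ∃ (N : ℕ) (S : Set E), S.Finite ∧
      AlgebraicIndependent (adjoin k S) (fun n : {n : ℕ // N ≤ n} ↦ t n) ∧
      adjoin (adjoin k S) (Set.range fun n : {n : ℕ // N ≤ n} ↦ t n) = ⊤ := by
  have : Algebra.IsAlgebraic (Algebra.adjoin k (Set.range t ∪ s)) E := by
    rw [← isAlgebraic_adjoin_iff_top, htop]
    exact ⟨fun x ↦ isAlgebraic_algebraMap (⟨x, mem_top⟩ : (⊤ : IntermediateField k E))⟩
  obtain ⟨B, htB, hBs, hB⟩ := exists_isTranscendenceBasis_between (R := k) (Set.range t)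
    (Set.range t ∪ s) Set.subset_union_left ht.to_subtype_range
  obtain ⟨I, hIB, hIfin, -, hsI⟩ :=
    (AlgebraicIndependent.matroid k E).exists_subset_finite_closure_of_subset_closure hs
      (Y := B) (by
        rw [(AlgebraicIndependent.matroid_isBase_iff.mpr hB).closure_eq]
        exact Set.subset_univ s)
  obtain ⟨N, hN⟩ := (hIfin.preimage ht.injective.injOn).bddAbove
  replace hN (n : ℕ) (hn : N + 1 ≤ n) : t n ∉ I := fun h ↦ by have := hN h; omega
  set T : Set E := t '' Set.Ici (N + 1)
  set D := B \ T
  have hID : I ⊆ D := fun x hx ↦ ⟨hIB hx, by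
    rintro ⟨n, hn, rfl⟩
    exact hN n hn hx⟩
  have hDfin : D.Finite := by
    refine (((Set.finite_Iio (N + 1)).image t).union hs).subset ?_
    rintro x ⟨hxB, hxT⟩
    rcases hBs hxB with ⟨n, rfl⟩ | hx
    · exact .inl ⟨n, Set.mem_Iio.mpr (not_le.mp fun h ↦ hxT ⟨n, h, rfl⟩), rfl⟩
    · exact .inr hx
  have hind : AlgebraicIndependent (adjoin k D) (fun n : {n : ℕ // N + 1 ≤ n} ↦ t n) := by
    rw [algebraicIndependent_adjoin_iff]
    have h := hB.1.adjoin_of_disjoint (s := Subtype.val ⁻¹' D) (t := Subtype.val ⁻¹' T)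
      (Disjoint.preimage _ Set.disjoint_sdiff_left)
    rw [Subtype.image_preimage_coe, Set.inter_eq_right.mpr Set.sdiff_subset] at h
    exact h.comp
      (fun n : {n : ℕ // N + 1 ≤ n} ↦ ⟨⟨t n, htB ⟨n, rfl⟩⟩, ⟨n, n.2, rfl⟩⟩)
      fun m n h ↦ Subtype.ext (ht.injective congr($h.1.1))
  have halg : Algebra.IsAlgebraic (adjoin k D) (adjoin (adjoin k D) s) := by
    refine isAlgebraic_adjoin fun x hx ↦ IsAlgebraic.isIntegral ?_
    rw [isAlgebraic_adjoin_iff]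
    have h := (AlgebraicIndependent.matroid k E).closure_subset_closure hID (hsI hx)
    rwa [AlgebraicIndependent.matroid_closure_eq] at h
  refine ⟨N + 1, D ∪ s, hDfin.union hs, ?_, ?_⟩
  · rw [← adjoin_adjoin_left]
    exact hind.extendScalars (adjoin (adjoin k D) s)
  · refine restrictScalars_injective k ?_
    rw [adjoin_adjoin_left, restrictScalars_top, eq_top_iff, ← htop]
    refine adjoin.mono _ _ _ (Set.union_subset ?_ fun x hx ↦ .inl (.inr hx))
    rintro _ ⟨n, rfl⟩
    by_cases hn : N + 1 ≤ n
    · exact .inr ⟨⟨n, hn⟩, rfl⟩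
    · refine .inl (.inl ⟨htB ⟨n, rfl⟩, ?_⟩)
      rintro ⟨m, hm, hmn⟩
      exact hn (ht.injective hmn ▸ hm)

/-- The field `k(S)` is generated as a field by the image of `k` and finitely many elements when
`S` is finite. -/
theorem IntermediateField.exists_finset_closure_adjoin_eq_top {k E : Type*} [Field k] [Field E]
    [Algebra k E] {S : Set E} (hS : S.Finite) :
    ∃ s : Finset (adjoin k S),
      Subfield.closure (Set.range (algebraMap k (adjoin k S)) ∪ ↑s) = ⊤ := by
  have hfin : (Subtype.val ⁻¹' S : Set (adjoin k S)).Finite :=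
    hS.preimage Subtype.val_injective.injOn
  refine ⟨hfin.toFinset, ?_⟩
  rw [hfin.coe_toFinset]
  have h₁ : algebraMap (adjoin k S) E '' (Subtype.val ⁻¹' S) = S :=
    (Subtype.image_preimage_coe _ _).trans (Set.inter_eq_right.mpr (subset_adjoin k S))
  have h₂ : algebraMap (adjoin k S) E ∘ algebraMap k (adjoin k S) = algebraMap k E := rfl
  have hmap : (Subfield.closure (Set.range (algebraMap k (adjoin k S)) ∪ Subtype.val ⁻¹' S)).map
      (algebraMap (adjoin k S) E) = (adjoin k S).toSubfield := by
    rw [RingHom.map_field_closure, Set.image_union, ← Set.range_comp, h₁, h₂, adjoin_toSubfield]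
  refine eq_top_iff.mpr fun x _ ↦ ?_
  obtain ⟨y, hy, hyx⟩ := Subfield.mem_map.mp (hmap.ge x.2)
  rwa [← Subtype.ext (a1 := y) (a2 := x) hyx]

/-- The fraction field of a polynomial ring is generated by the variables: adjoining their images
and a set `s` to the base field is the same as adjoining `s` to the rational function field. -/
theorem MvPolynomial.restrictScalars_adjoin_fractionRing {σ k K E : Type*} [Field k] [Field K]
    [Algebra (MvPolynomial σ k) K] [IsFractionRing (MvPolynomial σ k) K] [Algebra k K]
    [IsScalarTower k (MvPolynomial σ k) K] [Field E] [Algebra K E] [Algebra k E]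
    [IsScalarTower k K E] (s : Set E) :
    (IntermediateField.adjoin K s).restrictScalars k =
      IntermediateField.adjoin k
        (Set.range (fun i : σ ↦ algebraMap K E (algebraMap (MvPolynomial σ k) K (X i))) ∪ s) := by
  set L := IntermediateField.adjoin k
    (Set.range (fun i : σ ↦ algebraMap K E (algebraMap (MvPolynomial σ k) K (X i))) ∪ s)
  have hpoly (p : MvPolynomial σ k) : algebraMap K E (algebraMap _ K p) ∈ L := by
    induction p using MvPolynomial.induction_on with
    | C a =>
      rw [← algebraMap_eq, ← IsScalarTower.algebraMap_apply k _ K,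
        ← IsScalarTower.algebraMap_apply k K E]
      exact L.algebraMap_mem a
    | add p q hp hq => simpa using add_mem hp hq
    | mul_X p i hp =>
      simpa using mul_mem hp (IntermediateField.subset_adjoin k _ (.inl ⟨i, rfl⟩))
  have hK (x : K) : algebraMap K E x ∈ L := by
    obtain ⟨p, q, -, rfl⟩ := IsFractionRing.div_surjective (A := MvPolynomial σ k) x
    simpa using div_mem (hpoly p) (hpoly q)
  refine le_antisymm (fun x hx ↦ ?_) (IntermediateField.adjoin_le_iff.mpr ?_)
  · rw [IntermediateField.mem_restrictScalars] at hx
    induction hx using IntermediateField.adjoin_induction with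
    | mem x hx => exact IntermediateField.subset_adjoin k _ (.inr hx)
    | algebraMap x => exact hK x
    | add x y _ _ hx hy => exact add_mem hx hy
    | inv x _ hx => exact inv_mem hx
    | mul x y _ _ hx hy => exact mul_mem hx hy
  · rintro x (⟨i, rfl⟩ | hx)
    · exact (IntermediateField.adjoin K s).algebraMap_mem _
    · exact IntermediateField.subset_adjoin K s hx

theorem stmt1 {k₀ : Type u} [Field k₀] (E : Type u) [Field E]
    [Algebra (FractionRing (MvPolynomial ℕ k₀)) E]
    (hfg : (⊤ : IntermediateField (FractionRing (MvPolynomial ℕ k₀)) E).FG) :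
    ∃ N : ℕ, Nonempty (PTPresentation k₀ E
      (fun n => algebraMap (FractionRing (MvPolynomial ℕ k₀)) E
        (algebraMap (MvPolynomial ℕ k₀) (FractionRing (MvPolynomial ℕ k₀))
          (MvPolynomial.X n))) N) := by
  let K := FractionRing (MvPolynomial ℕ k₀)
  let _ : Algebra k₀ E := ((algebraMap K E).comp (algebraMap k₀ K)).toAlgebra
  have : IsScalarTower k₀ K E := .of_algebraMap_eq fun _ ↦ rfl
  obtain ⟨s, hs⟩ := hfg
  have ht : AlgebraicIndependent k₀
      (fun n : ℕ ↦ algebraMap K E (algebraMap (MvPolynomial ℕ k₀) K (MvPolynomial.X n))) :=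
    ((MvPolynomial.algebraicIndependent_X ℕ k₀).map'
      (f := IsScalarTower.toAlgHom k₀ (MvPolynomial ℕ k₀) K)
      (IsFractionRing.injective _ K)).map'
      (f := IsScalarTower.toAlgHom k₀ K E) (algebraMap K E).injective
  have htop := MvPolynomial.restrictScalars_adjoin_fractionRing (σ := ℕ) (k := k₀) (K := K)
    (s : Set E)
  rw [hs, IntermediateField.restrictScalars_top] at htop
  obtain ⟨N, S, hS, hind, hgen⟩ :=
    exists_finite_tail_algebraicIndependent ht s.finite_toSet htop.symm
  refine ⟨N, ⟨{
    E₀ := IntermediateField.adjoin k₀ S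
    emb := algebraMap k₀ _
    fg := IntermediateField.exists_finset_closure_adjoin_eq_top hS
    iso := ((hind.aevalEquivField.trans (IntermediateField.equivOfEq hgen)).trans
      IntermediateField.topEquiv).symm.toRingEquiv
    iso_t := fun n h ↦ ?_ }⟩⟩
  refine (AlgEquiv.symm_apply_eq _).mpr ?_
  refine Eq.trans ?_ (hind.aevalEquivField_algebraMap_apply_coe (MvPolynomial.X ⟨n, h⟩)).symm
  rw [MvPolynomial.aeval_X]
end

section
/- Let k be a flexible field, X a scheme of finite type over k, and E a finitely generated purely transcendental field extension of k. Then there exist a subfield k₀ ⊆ k over which k is purely transcendental of countably infinite degree, a field isomorphism σ : k → E fixing k₀, and an isomorphism of schemes X → X ×_{Spec k} Spec E (the base change of X along the structural inclusion k ⊆ E) which lies over the isomorphism of Spec E with Spec k induced by σ, i.e., the square formed by the two structure morphisms and these two isomorphisms commutes. -/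
set_option synthInstance.maxHeartbeats 1000000
set_option maxHeartbeats 1000000
universe u

open AlgebraicGeometry CategoryTheory CategoryTheory.Limits

/-- The filter of endomorphisms of `k` generated by the pointwise stabilizers of finite subsets. -/
def fixingFilter (k : Type u) [Field k] : Filter (k →+* k) :=
  ⨅ a : k, Filter.principal {τ | τ a = a}

lemma eventually_fixingFilter_apply_eq {k : Type u} [Field k] (a : k) :
    ∀ᶠ τ in fixingFilter k, τ a = a :=
  Filter.mem_iInf_of_mem a (Filter.mem_principal_self _)

lemma exists_finite_of_eventually_fixingFilter {k : Type u} [Field k] {P : (k →+* k) → Prop}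
    (h : ∀ᶠ τ in fixingFilter k, P τ) :
    ∃ F : Set k, F.Finite ∧ ∀ τ : k →+* k, (∀ a ∈ F, τ a = a) → P τ := by
  obtain ⟨F, hF, h⟩ := (Filter.hasBasis_iInf_principal_finite _).eventually_iff.mp h
  exact ⟨F, hF, fun τ hτ ↦ h (by simpa using hτ)⟩

lemma MvPolynomial.eventually_map_eq {k : Type u} [Field k] {σ : Type*} (p : MvPolynomial σ k) :
    ∀ᶠ τ in fixingFilter k, MvPolynomial.map τ p = p := by
  have : ∀ᶠ τ in fixingFilter k, ∀ m ∈ p.support, τ (p.coeff m) = p.coeff m :=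
    (Filter.eventually_all_finset _).mpr fun m _ ↦ eventually_fixingFilter_apply_eq _
  filter_upwards [this] with τ hτ
  ext m
  rw [MvPolynomial.coeff_map]
  by_cases hm : m ∈ p.support
  · exact hτ m hm
  · simp [MvPolynomial.notMem_support_iff.mp hm]

/-- A finitely generated algebra over a field `k` carries semilinear endomorphisms along every
endomorphism of `k` fixing enough elements; they exhibit it as its own base change. -/
lemma exists_semilinear_endomorphisms {k : Type u} [Field k] {A : Type u} [CommRing A]
    [Algebra k A] [Algebra.FiniteType k A] :
    ∃ θ : (k →+* k) → (A →+* A), (∀ a, ∀ᶠ τ in fixingFilter k, θ τ a = a) ∧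
      ∀ᶠ τ in fixingFilter k, IsPushout (CommRingCat.ofHom τ)
        (CommRingCat.ofHom (algebraMap k A)) (CommRingCat.ofHom (algebraMap k A))
        (CommRingCat.ofHom (θ τ)) := by
  obtain ⟨n, π, hπ, s, hs⟩ := (
    Algebra.FinitePresentation.of_finiteType.mp ‹Algebra.FiniteType k A›)
  have hker (p) : p ∈ Ideal.span (s : Set (MvPolynomial (Fin n) k)) ↔ π p = 0 := by
    rw [hs]; rfl
  have key : ∀ τ : k →+* k, ∃ θ : A →+* A, (∀ p ∈ s, MvPolynomial.map τ p = p) →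
      ∀ p, θ (π p) = π (MvPolynomial.map τ p) := by
    intro τ
    by_cases h : ∀ p ∈ s, MvPolynomial.map τ p = p
    · refine ⟨RingHom.liftOfSurjective π.toRingHom hπ
        ⟨π.toRingHom.comp (MvPolynomial.map τ), ?_⟩, fun _ p ↦ ?_⟩
      · rw [← hs, Ideal.span_le]
        intro p hp
        have : π p = 0 := (hker p).mp (Ideal.subset_span hp)
        simp [h p hp, this]
      · exact RingHom.liftOfRightInverse_comp_apply _ _ _ _ p
    · exact ⟨RingHom.id A, fun h' ↦ (h h').elim⟩
  choose θ hθ using key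
  have hev : ∀ᶠ τ in fixingFilter k, ∀ p ∈ s, MvPolynomial.map τ p = p :=
    (Filter.eventually_all_finset _).mpr fun p _ ↦ MvPolynomial.eventually_map_eq p
  refine ⟨θ, fun a ↦ ?_, ?_⟩
  · obtain ⟨p, rfl⟩ := hπ a
    filter_upwards [hev, MvPolynomial.eventually_map_eq p] with τ hτ hp
    rw [hθ τ hτ, hp]
  · filter_upwards [hev] with τ hτ
    have hsq (a : k) : θ τ (algebraMap k A a) = algebraMap k A (τ a) := by
      simpa using hθ τ hτ (MvPolynomial.C a)
    have hX (i : Fin n) : θ τ (π (.X i)) = π (.X i) := by simpa using hθ τ hτ (.X i)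
    let g (c : PushoutCocone (CommRingCat.ofHom τ) (CommRingCat.ofHom (algebraMap k A))) :
        MvPolynomial (Fin n) k →+* c.pt :=
      MvPolynomial.eval₂Hom c.inl.hom fun i ↦ c.inr.hom (π (.X i))
    have hg (c) (p) : g c (MvPolynomial.map τ p) = c.inr.hom (π p) := by
      suffices (g c).comp (MvPolynomial.map τ) = c.inr.hom.comp π.toRingHom from
        congr($this p)
      refine MvPolynomial.ringHom_ext (fun a ↦ ?_) (fun i ↦ by simp [g])
      simpa [g] using congr(($c.condition).hom a)
    have hlift (c) : Ideal.span s ≤ RingHom.ker (g c) := by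
      rw [Ideal.span_le]
      intro p hp
      have := hg c p
      rwa [hτ p hp, (hker p).mp (Ideal.subset_span hp), map_zero] at this
    let γ (c : PushoutCocone (CommRingCat.ofHom τ) (CommRingCat.ofHom (algebraMap k A))) :
        A →+* c.pt := RingHom.liftOfSurjective π.toRingHom hπ ⟨g c, hs ▸ hlift c⟩
    have hγ (c) (p) : γ c (π p) = g c p := RingHom.liftOfRightInverse_comp_apply _ _ _ _ p
    refine ⟨⟨by ext a; exact (hsq a).symm⟩, ⟨PushoutCocone.IsColimit.mk _
      (fun c ↦ CommRingCat.ofHom (γ c)) (fun c ↦ ?_) (fun c ↦ ?_) (fun c m h1 h2 ↦ ?_)⟩⟩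
    · ext a
      change γ c (algebraMap k A a) = _
      rw [← π.commutes, hγ]
      simp [g, MvPolynomial.algebraMap_eq]
    · ext a
      obtain ⟨p, rfl⟩ := hπ a
      change γ c (θ τ (π p)) = _
      rw [hθ τ hτ, hγ, hg]
    · ext a
      obtain ⟨p, rfl⟩ := hπ a
      change m.hom (π p) = γ c (π p)
      rw [hγ]
      suffices m.hom.comp π.toRingHom = g c from congr($this p)
      refine MvPolynomial.ringHom_ext (fun a ↦ ?_) (fun i ↦ ?_)
      · have := congr(($h1).hom a)
        simpa [g, ← MvPolynomial.algebraMap_eq] using this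
      · have := congr(($h2).hom (π (.X i)))
        simpa [g, hX] using this

section Model

variable {k : Type u} [Field k]

/-- A family of endomorphisms of a `k`-scheme `Y`, indexed by the endomorphisms of `k`, that
exhibits `Y` as its own base change along all endomorphisms of `k` fixing enough elements and in
the limit fixes every global function. -/
structure IsModel {Y : Scheme.{u}} (p : Y ⟶ Spec (.of k)) (φ : (k →+* k) → (Y ⟶ Y)) : Prop where
  isPullback : ∀ᶠ τ in fixingFilter k, IsPullback (φ τ) p p (Spec.map (CommRingCat.ofHom τ))
  appTop_apply (s : Γ(Y, ⊤)) : ∀ᶠ τ in fixingFilter k, (φ τ).appTop s = s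

lemma exists_isModel {Y : Scheme.{u}} [IsAffine Y] (p : Y ⟶ Spec (.of k)) [LocallyOfFiniteType p] :
    ∃ φ, IsModel p φ := by
  let ρ := (Scheme.ΓSpecIso (.of k)).inv ≫ p.appTop
  algebraize [ρ.hom]
  have : Algebra.FiniteType k Γ(Y, ⊤) := by
    have h : p.appTop.hom.FiniteType := HasRingHomProperty.appTop @LocallyOfFiniteType p ‹_›
    exact h.comp (RingHom.FiniteType.of_surjective _
      (ConcreteCategory.bijective_of_isIso (Scheme.ΓSpecIso (.of k)).inv).2)
  have hp : p = Y.isoSpec.hom ≫ Spec.map ρ := by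
    simp [ρ, Scheme.isoSpec_hom, ← Scheme.toSpecΓ_naturality_assoc]
  obtain ⟨θ, h1, h2⟩ := exists_semilinear_endomorphisms (k := k) (A := Γ(Y, ⊤))
  refine ⟨fun τ ↦ Y.isoSpec.hom ≫ Spec.map (CommRingCat.ofHom (θ τ)) ≫ Y.isoSpec.inv, ?_, ?_⟩
  · filter_upwards [h2] with τ hτ
    have := isPullback_SpecMap_of_isPushout _ _ _ _ hτ
    refine this.flip.of_iso Y.isoSpec.symm Y.isoSpec.symm (Iso.refl _) (Iso.refl _) ?_ ?_ ?_ ?_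
    · simp
    · simp [hp]; rfl
    · simp [hp]; rfl
    · simp
  · intro s
    filter_upwards [h1 s] with τ hτ
    have h : (Y.isoSpec.hom ≫ Spec.map (CommRingCat.ofHom (θ τ)) ≫ Y.isoSpec.inv).appTop =
        CommRingCat.ofHom (θ τ) := by
      have hinv : Y.isoSpec.inv.appTop = (Scheme.ΓSpecIso _).inv := by
        rw [← cancel_epi (Scheme.ΓSpecIso Γ(Y, ⊤)).hom, Iso.hom_inv_id, ← Scheme.toSpecΓ_appTop,
          ← Scheme.isoSpec_hom, ← Scheme.Hom.comp_appTop, Iso.inv_hom_id, Scheme.Hom.id_appTop]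
      rw [Scheme.Hom.comp_appTop, Scheme.Hom.comp_appTop, hinv, Scheme.isoSpec_hom,
        Scheme.toSpecΓ_appTop, Category.assoc, Scheme.ΓSpecIso_naturality]
      exact Iso.inv_hom_id_assoc _ _
    rw [h]
    exact hτ

lemma IsModel.eventually_naturality {Y Z : Scheme.{u}} [IsAffine Z] {p : Z ⟶ Spec (.of k)}
    [LocallyOfFiniteType p] (e : Y ⟶ Z) {φ ψ} (hφ : IsModel (e ≫ p) φ) (hψ : IsModel p ψ) :
    ∀ᶠ τ in fixingFilter k, φ τ ≫ e = e ≫ ψ τ := by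
  have h : p.appTop.hom.FiniteType := HasRingHomProperty.appTop @LocallyOfFiniteType p ‹_›
  algebraize [p.appTop.hom]
  obtain ⟨s, hs⟩ := Algebra.FiniteType.out (R := Γ(Spec (.of k), ⊤)) (A := Γ(Z, ⊤))
  have h1 : ∀ᶠ τ in fixingFilter k, ∀ a ∈ s, (φ τ).appTop (e.appTop a) = e.appTop a :=
    (Filter.eventually_all_finset _).mpr fun a _ ↦ hφ.appTop_apply _
  have h2 : ∀ᶠ τ in fixingFilter k, ∀ a ∈ s, (ψ τ).appTop a = a :=
    (Filter.eventually_all_finset _).mpr fun a _ ↦ hψ.appTop_apply _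
  filter_upwards [h1, h2, hφ.isPullback, hψ.isPullback] with τ h1 h2 hφ hψ
  have hp : (φ τ ≫ e) ≫ p = (e ≫ ψ τ) ≫ p := by
    simpa [hψ.w] using hφ.w
  apply ext_of_isAffine
  ext a
  rw [Scheme.Hom.comp_appTop, Scheme.Hom.comp_appTop]
  change (φ τ).appTop (e.appTop a) = e.appTop ((ψ τ).appTop a)
  have ha : a ∈ Algebra.adjoin Γ(Spec (.of k), ⊤) (s : Set Γ(Z, ⊤)) := hs ▸ Algebra.mem_top
  induction ha using Algebra.adjoin_induction with
  | mem a ha => rw [h1 a ha, h2 a ha]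
  | algebraMap r =>
    have := congr($(congr(Scheme.Hom.appTop $hp)) r)
    simp only [Scheme.Hom.comp_appTop] at this
    exact this
  | add x y _ _ hx hy => simp only [map_add, hx, hy]
  | mul x y _ _ hx hy => simp only [map_mul, hx, hy]


/-- If `U` is over `X` and `Y` is both the pullback of `U` to `X'` and the pullback of `U` along
`t`, then `Y` is also the pullback of `U ×[S] S'` along the comparison map `X' ⟶ X ×[S] S'`. -/
lemma isPullback_lift {X X' S S' U Y : Scheme.{u}} {h : X' ⟶ X} {f' : X' ⟶ S'} {f : X ⟶ S}
    {t : S' ⟶ S} (w : h ≫ f = f' ≫ t) {u : U ⟶ X} {ι : Y ⟶ X'} {φ : Y ⟶ U}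
    (H₁ : IsPullback φ ι u h) (H₂ : IsPullback φ (ι ≫ f') (u ≫ f) t)
    {v : pullback (u ≫ f) t ⟶ pullback f t}
    (hfst : v ≫ pullback.fst f t = pullback.fst (u ≫ f) t ≫ u)
    (hsnd : v ≫ pullback.snd f t = pullback.snd (u ≫ f) t) :
    IsPullback ι H₂.isoPullback.hom (pullback.lift h f' w) v := by
  have h1 : IsPullback v (pullback.fst (u ≫ f) t) (pullback.fst f t) u := by
    refine .of_right (h₁₂ := pullback.snd f t) (h₂₂ := f) (v₁₃ := t) ?_ hfst
      (IsPullback.of_hasPullback f t).flip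
    rw [hsnd]
    exact (IsPullback.of_hasPullback (u ≫ f) t).flip
  refine .of_bot ?_ ?_ h1
  · rw [IsPullback.isoPullback_hom_fst, pullback.lift_fst]
    exact H₁.flip
  · apply pullback.hom_ext
    · rw [Category.assoc, pullback.lift_fst, Category.assoc, hfst,
        IsPullback.isoPullback_hom_fst_assoc, H₁.w]
    · rw [Category.assoc, pullback.lift_snd, Category.assoc, hsnd,
        IsPullback.isoPullback_hom_snd]

/-- Being a pullback square can be checked on an open cover that the square respects. -/
lemma isPullback_of_openCover {X X' S S' : Scheme.{u}} {h : X' ⟶ X} {f' : X' ⟶ S'} {f : X ⟶ S}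
    {t : S' ⟶ S} (w : h ≫ f = f' ≫ t) (𝒰 : X.OpenCover) (Y : 𝒰.I₀ → Scheme.{u})
    (ι : ∀ i, Y i ⟶ X') (φ : ∀ i, Y i ⟶ 𝒰.X i) (H₁ : ∀ i, IsPullback (φ i) (ι i) (𝒰.f i) h)
    (H₂ : ∀ i, IsPullback (φ i) (ι i ≫ f') (𝒰.f i ≫ f) t) : IsPullback h f' f t := by
  let c : X' ⟶ pullback f t := pullback.lift h f' w
  let 𝒱 := Scheme.Pullback.openCoverOfLeft 𝒰 f t
  have : IsIso c := by
    refine IsZariskiLocalAtTarget.of_openCover (P := .isomorphisms Scheme) 𝒱 fun i ↦ ?_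
    have h2 : IsPullback (ι i) (H₂ i).isoPullback.hom c (𝒱.f i) :=
      isPullback_lift w (H₁ i) (H₂ i) (pullback.lift_fst _ _ _)
        ((pullback.lift_snd _ _ _).trans (Category.comp_id _))
    have h3 : 𝒱.pullbackHom c i = h2.isoPullback.inv ≫ (H₂ i).isoPullback.hom :=
      h2.isoPullback_inv_snd.symm
    rw [h3]
    exact (h2.isoPullback.symm ≪≫ (H₂ i).isoPullback).isIso_hom
  exact .of_iso_pullback ⟨w⟩ (asIso c) (pullback.lift_fst _ _ _) (pullback.lift_snd _ _ _)

/-- A scheme of finite type over a field `k` is its own base change along every endomorphism of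
`k` fixing enough elements. -/
theorem eventually_exists_isPullback {X : Scheme.{u}} (f : X ⟶ Spec (.of k))
    [LocallyOfFiniteType f] [QuasiCompact f] :
    ∀ᶠ τ in fixingFilter k, ∃ h : X ⟶ X, IsPullback h f f (Spec.map (CommRingCat.ofHom τ)) := by
  have : IsLocallyNoetherian X := LocallyOfFiniteType.isLocallyNoetherian f
  have : CompactSpace X := QuasiCompact.compactSpace_of_compactSpace f
  let 𝒰 : X.OpenCover := X.affineCover.finiteSubcover
  let 𝒲 (i j : 𝒰.I₀) : (pullback (𝒰.f i) (𝒰.f j)).OpenCover :=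
    (pullback (𝒰.f i) (𝒰.f j)).affineCover.finiteSubcover
  let a i j (l : (𝒲 i j).I₀) : (𝒲 i j).X l ⟶ 𝒰.X i := (𝒲 i j).f l ≫ pullback.fst _ _
  let b i j (l : (𝒲 i j).I₀) : (𝒲 i j).X l ⟶ 𝒰.X j := (𝒲 i j).f l ≫ pullback.snd _ _
  have hab i j l : a i j l ≫ 𝒰.f i = b i j l ≫ 𝒰.f j := by simp [a, b, pullback.condition]
  choose φ hφ using fun i ↦ exists_isModel (𝒰.f i ≫ f)
  choose ψ hψ using fun i j l ↦ exists_isModel (a i j l ≫ 𝒰.f i ≫ f)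
  have hψ' i j l : IsModel (b i j l ≫ 𝒰.f j ≫ f) (ψ i j l) := by
    rw [← Category.assoc, ← hab, Category.assoc]; exact hψ i j l
  have e1 : ∀ᶠ τ in fixingFilter k, ∀ i j l, ψ i j l τ ≫ a i j l = a i j l ≫ φ i τ := by
    simp_rw [Filter.eventually_all]
    exact fun i j l ↦ (hψ i j l).eventually_naturality _ (hφ i)
  have e2 : ∀ᶠ τ in fixingFilter k, ∀ i j l, ψ i j l τ ≫ b i j l = b i j l ≫ φ j τ := by
    simp_rw [Filter.eventually_all]
    exact fun i j l ↦ (hψ' i j l).eventually_naturality _ (hφ j)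
  have e3 : ∀ᶠ τ in fixingFilter k, ∀ i, IsPullback (φ i τ) (𝒰.f i ≫ f) (𝒰.f i ≫ f)
      (Spec.map (CommRingCat.ofHom τ)) := by
    simp_rw [Filter.eventually_all]
    exact fun i ↦ (hφ i).isPullback
  have e4 : ∀ᶠ τ in fixingFilter k, ∀ i j l, IsPullback (ψ i j l τ) (b i j l ≫ 𝒰.f j ≫ f)
      (b i j l ≫ 𝒰.f j ≫ f) (Spec.map (CommRingCat.ofHom τ)) := by
    simp_rw [Filter.eventually_all]
    exact fun i j l ↦ (hψ' i j l).isPullback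
  filter_upwards [e1, e2, e3, e4] with τ e1 e2 e3 e4
  let h : X ⟶ X := 𝒰.glueMorphisms (fun i ↦ φ i τ ≫ 𝒰.f i) fun i j ↦ by
    refine Scheme.Cover.hom_ext (𝒲 i j) _ _ fun l ↦ ?_
    have h1 := e1 i j l
    have h2 := e2 i j l
    calc _ = a i j l ≫ φ i τ ≫ 𝒰.f i := by simp [a]
      _ = b i j l ≫ φ j τ ≫ 𝒰.f j := by
        rw [← reassoc_of% h1, ← reassoc_of% h2, hab]
      _ = _ := by simp [b]
  have hh i : 𝒰.f i ≫ h = φ i τ ≫ 𝒰.f i := 𝒰.ι_glueMorphisms _ _ i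
  have w : h ≫ f = f ≫ Spec.map (CommRingCat.ofHom τ) := by
    refine Scheme.Cover.hom_ext 𝒰 _ _ fun i ↦ ?_
    simpa [reassoc_of% hh i] using (e3 i).w
  refine ⟨h, isPullback_of_openCover w 𝒰 _ 𝒰.f (φ · τ) (fun i ↦ ?_) e3⟩
  refine IsOpenImmersion.isPullback _ _ _ _ (hh i) (le_antisymm ?_ ?_)
  · intro x hx
    obtain ⟨y, hy⟩ : ∃ y, 𝒰.f i y = h x := hx
    obtain ⟨j, x, rfl⟩ := 𝒰.exists_eq x
    have hx' : h (𝒰.f j x) = 𝒰.f j (φ j τ x) := by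
      rw [← Scheme.Hom.comp_apply, hh, Scheme.Hom.comp_apply]
    obtain ⟨z, hz₁, hz₂⟩ := Scheme.Pullback.exists_preimage_pullback y (φ j τ x) (hy.trans hx')
    obtain ⟨l, v, rfl⟩ := (𝒲 i j).exists_eq z
    have hp : IsPullback (ψ i j l τ) (b i j l) (b i j l) (φ j τ) :=
      .of_bot (e4 i j l) (e2 i j l) (e3 j)
    obtain ⟨u, hu₁, hu₂⟩ := Scheme.Pullback.exists_preimage_pullback (f := b i j l) (g := φ j τ)
      v x (by simpa [b] using hz₂)
    refine ⟨a i j l (hp.isoPullback.inv u), ?_⟩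
    have hx : b i j l (hp.isoPullback.inv u) = x := by
      rw [← Scheme.Hom.comp_apply, hp.isoPullback_inv_snd, hu₂]
    rw [← Scheme.Hom.comp_apply, hab, Scheme.Hom.comp_apply, hx]
  · rintro _ ⟨y, rfl⟩
    exact ⟨φ i τ y, by rw [← Scheme.Hom.comp_apply, ← hh, Scheme.Hom.comp_apply]⟩

end Model

section PurelyTranscendental

variable {K L : Type*} [Field K] [Field L] [Algebra K L] {ι : Type*}

lemma AlgebraicIndependent.nonempty_algEquiv {x : ι → L} (hx : AlgebraicIndependent K x)
    (h : IntermediateField.adjoin K (Set.range x) = ⊤) :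
    Nonempty (L ≃ₐ[K] FractionRing (MvPolynomial ι K)) :=
  ⟨(hx.aevalEquivField.trans
    ((IntermediateField.equivOfEq h).trans IntermediateField.topEquiv)).symm⟩

lemma exists_algebraicIndependent_adjoin_eq_top (e : L ≃ₐ[K] FractionRing (MvPolynomial ι K)) :
    ∃ x : ι → L, AlgebraicIndependent K x ∧ IntermediateField.adjoin K (Set.range x) = ⊤ := by
  let y (i : ι) := algebraMap (MvPolynomial ι K) (FractionRing (MvPolynomial ι K)) (.X i)
  have hy : AlgebraicIndependent K y :=
    (MvPolynomial.algebraicIndependent_X ι K).map'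
      (f := IsScalarTower.toAlgHom K (MvPolynomial ι K) (FractionRing (MvPolynomial ι K)))
      (IsFractionRing.injective _ _)
  have hy' : IntermediateField.adjoin K (Set.range y) = ⊤ := by
    refine top_le_iff.mp fun z _ ↦ ?_
    obtain ⟨p, q, -, rfl⟩ := IsFractionRing.div_surjective (A := MvPolynomial ι K) z
    suffices h : ∀ p : MvPolynomial ι K, algebraMap _ (FractionRing (MvPolynomial ι K)) p ∈
        IntermediateField.adjoin K (Set.range y) from div_mem (h p) (h q)
    intro p
    induction p using MvPolynomial.induction_on with
    | C a =>
      rw [← MvPolynomial.algebraMap_eq, ← IsScalarTower.algebraMap_apply]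
      exact IntermediateField.algebraMap_mem _ a
    | add p q hp hq => rw [map_add]; exact add_mem hp hq
    | mul_X p i hp =>
      rw [map_mul]
      exact mul_mem hp (IntermediateField.subset_adjoin _ _ ⟨i, rfl⟩)
  refine ⟨e.symm ∘ y, hy.map' (f := e.symm.toAlgHom) e.symm.injective, ?_⟩
  have := congr(($hy').map e.symm.toAlgHom)
  rw [IntermediateField.adjoin_map, ← Set.range_comp] at this
  refine this.trans ?_
  rw [← AlgHom.fieldRange_eq_map]
  exact AlgHom.fieldRange_eq_top.mpr e.symm.surjective

lemma AlgebraicIndependent.add_left {x : ℕ → L} (hx : AlgebraicIndependent K x) (n : ℕ) :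
    AlgebraicIndependent (IntermediateField.adjoin K (x '' Set.Iio n)) fun i ↦ x (n + i) := by
  rw [IntermediateField.algebraicIndependent_adjoin_iff]
  have : Disjoint (Set.Iio n) (Set.Ici n) := Set.Iio_disjoint_Ici le_rfl
  exact (hx.adjoin_of_disjoint this).comp (fun i ↦ (⟨n + i, by simp⟩ : Set.Ici n))
    fun i j h ↦ by simpa using h

lemma adjoin_range_add_left_eq_top {x : ℕ → L}
    (h : IntermediateField.adjoin K (Set.range x) = ⊤) (n : ℕ) :
    IntermediateField.adjoin (IntermediateField.adjoin K (x '' Set.Iio n))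
      (Set.range fun i ↦ x (n + i)) = ⊤ := by
  rw [← IntermediateField.restrictScalars_eq_top_iff (K := K),
    IntermediateField.adjoin_adjoin_left, ← h]
  congr 1
  ext a
  constructor
  · rintro (⟨i, -, rfl⟩ | ⟨i, rfl⟩)
    exacts [⟨i, rfl⟩, ⟨n + i, rfl⟩]
  · rintro ⟨i, rfl⟩
    obtain hi | hi := lt_or_ge i n
    · exact .inl ⟨i, hi, rfl⟩
    · exact .inr ⟨i - n, congr(x $(Nat.add_sub_cancel' hi))⟩

lemma adjoin_range_sumElim_eq_top {E ι' : Type*} [Field E] [Algebra K E] [Algebra L E]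
    [IsScalarTower K L E] {x : ι → L} {y : ι' → E}
    (hx : IntermediateField.adjoin K (Set.range x) = ⊤)
    (hy : IntermediateField.adjoin L (Set.range y) = ⊤) :
    IntermediateField.adjoin K (Set.range (Sum.elim y (algebraMap L E ∘ x))) = ⊤ := by
  set M := IntermediateField.adjoin K (Set.range (Sum.elim y (algebraMap L E ∘ x)))
  have hL (a : L) : algebraMap L E a ∈ M := by
    have : IntermediateField.adjoin K (Set.range x) ≤
        M.comap (IsScalarTower.toAlgHom K L E) := by
      rw [IntermediateField.adjoin_le_iff]
      rintro _ ⟨i, rfl⟩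
      exact IntermediateField.subset_adjoin _ _ ⟨.inr i, rfl⟩
    exact this (hx ▸ IntermediateField.mem_top)
  refine top_le_iff.mp fun z _ ↦ ?_
  have hz : z ∈ IntermediateField.adjoin L (Set.range y) := hy ▸ IntermediateField.mem_top
  induction hz using IntermediateField.adjoin_induction with
  | mem z hz =>
    obtain ⟨i, rfl⟩ := hz
    exact IntermediateField.subset_adjoin _ _ ⟨.inl i, rfl⟩
  | algebraMap a => exact hL a
  | add a b _ _ ha hb => exact add_mem (ha trivial) (hb trivial)
  | inv a _ ha => exact inv_mem (ha trivial)
  | mul a b _ _ ha hb => exact mul_mem (ha trivial) (hb trivial)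

lemma exists_subset_adjoin_image_Iio {x : ℕ → L}
    (h : IntermediateField.adjoin K (Set.range x) = ⊤) {F : Set L} (hF : F.Finite) :
    ∃ n, F ⊆ IntermediateField.adjoin K (x '' Set.Iio n) := by
  let M (n : ℕ) := IntermediateField.adjoin K (x '' Set.Iio n)
  have hM : Monotone M := fun a b hab ↦
    IntermediateField.adjoin.mono _ _ _ (Set.image_mono (Set.Iio_subset_Iio hab))
  have hx : ⨆ n, M n = ⊤ := by
    rw [← top_le_iff, ← h, IntermediateField.adjoin_le_iff]
    rintro _ ⟨i, rfl⟩
    exact le_iSup M (i + 1) (IntermediateField.subset_adjoin _ _ ⟨i, Nat.lt_succ_self i, rfl⟩)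
  have hF' : F ⊆ ⋃ n, (M n : Set L) := by
    rw [← IntermediateField.coe_iSup_of_directed hM.directed_le, hx]
    exact Set.subset_univ F
  have hd : Directed (· ⊆ ·) fun n ↦ (M n : Set L) := hM.directed_le
  simpa using hd.exists_mem_subset_of_finset_subset_biUnion (s := hF.toFinset) (by simpa)

end PurelyTranscendental

lemma exists_subfield_nonempty_algEquiv {k : Type u} [Field k] (hk : IsFlexible k)
    {E : Type u} [Field E] [Algebra k E]
    (hE : ∃ m : ℕ, Nonempty (E ≃ₐ[k] FractionRing (MvPolynomial (Fin m) k)))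
    {F : Set k} (hF : F.Finite) :
    ∃ k₀ : Subfield k, F ⊆ k₀ ∧ Nonempty (k ≃ₐ[k₀] FractionRing (MvPolynomial ℕ k₀)) ∧
      Nonempty (E ≃ₐ[k₀] FractionRing (MvPolynomial ℕ k₀)) := by
  obtain ⟨K, e⟩ := hk
  obtain ⟨m, ⟨e'⟩⟩ := hE
  algebraize [e.symm.toRingHom.comp (algebraMap K (FractionRing (MvPolynomial ℕ K)))]
  let e₁ : k ≃ₐ[K] FractionRing (MvPolynomial ℕ K) := AlgEquiv.ofRingEquiv (f := e)
    fun a ↦ e.apply_symm_apply _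
  obtain ⟨x, hx, hx'⟩ := exists_algebraicIndependent_adjoin_eq_top e₁
  obtain ⟨y, hy, hy'⟩ := exists_algebraicIndependent_adjoin_eq_top e'
  obtain ⟨n, hn⟩ := exists_subset_adjoin_image_Iio hx' hF
  have h1 := hx.add_left n
  have h2 := adjoin_range_add_left_eq_top hx' n
  have h3 := h1.sumElim_comp hy
  have h4 := adjoin_range_sumElim_eq_top h2 hy'
  let ε : ℕ ≃ Fin m ⊕ ℕ := (finSumNatEquiv m).symm
  refine ⟨(IntermediateField.adjoin K (x '' Set.Iio n)).toSubfield, hn,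
    h1.nonempty_algEquiv h2, (h3.comp ε ε.injective).nonempty_algEquiv ?_⟩
  rw [EquivLike.range_comp]
  exact h4

/-- Let `k` be a flexible field, `X` a scheme of finite type over `k` and `E` a finitely
generated purely transcendental field extension of `k`.  Then there are: a subfield `k₀` of `k`
over which `k` is purely transcendental of countably infinite degree, a field isomorphism
`σ : k ≃ E` fixing `k₀`, and an isomorphism of schemes `X ≅ X ×_{Spec k} Spec E` lying over the
isomorphism `Spec k ≅ Spec E` induced by `σ`. -/
theorem flexible_base_change_iso
    {k : Type u} [Field k] (hk : IsFlexible k)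
    {X : Scheme.{u}} (f : X ⟶ Spec (CommRingCat.of k))
    [LocallyOfFiniteType f] [QuasiCompact f]
    {E : Type u} [Field E] [Algebra k E]
    (hE : ∃ m : ℕ, Nonempty (E ≃ₐ[k] FractionRing (MvPolynomial (Fin m) k))) :
    ∃ k₀ : Subfield k,
      (∃ ψ : k ≃+* FractionRing (MvPolynomial ℕ k₀),
        ∀ x : k₀, ψ (x : k) =
          algebraMap (MvPolynomial ℕ k₀) (FractionRing (MvPolynomial ℕ k₀))
            (MvPolynomial.C x)) ∧
      ∃ σ : k ≃+* E,
        (∀ x : k₀, σ (x : k) = algebraMap k E (x : k)) ∧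
        ∃ g : X ≅ pullback f (Spec.map (CommRingCat.ofHom (algebraMap k E))),
          g.hom ≫ pullback.snd f (Spec.map (CommRingCat.ofHom (algebraMap k E))) =
            f ≫ Spec.map (CommRingCat.ofHom σ.symm.toRingHom) := by
  obtain ⟨F, hF, hFX⟩ :=
    exists_finite_of_eventually_fixingFilter (eventually_exists_isPullback f)
  obtain ⟨k₀, hk₀, ⟨ψ⟩, ⟨ε⟩⟩ := exists_subfield_nonempty_algEquiv hk hE hF
  let σ : k ≃ₐ[k₀] E := ψ.trans ε.symm
  refine ⟨k₀, ⟨ψ.toRingEquiv, ψ.commutes⟩, σ.toRingEquiv, σ.commutes, ?_⟩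
  let s := Spec.map (CommRingCat.ofHom σ.toRingEquiv.symm.toRingHom)
  let t := Spec.map (CommRingCat.ofHom (algebraMap k E))
  obtain ⟨h, H⟩ := hFX (σ.symm.toRingEquiv.toRingHom.comp (algebraMap k E))
    fun a ha ↦ σ.symm.commutes ⟨a, hk₀ ha⟩
  have hst : Spec.map (CommRingCat.ofHom
      (σ.symm.toRingEquiv.toRingHom.comp (algebraMap k E))) = s ≫ t := by
    rw [← Spec.map_comp]; rfl
  rw [hst] at H
  let g : X ⟶ pullback f t := pullback.lift h (f ≫ s) (by simpa using H.w)
  have hg : IsPullback g f (pullback.snd f t) s := by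
    refine .of_right (h₁₂ := pullback.fst f t) (h₂₂ := t) ?_ (pullback.lift_snd _ _ _)
      (IsPullback.of_hasPullback f t)
    rwa [pullback.lift_fst]
  have : IsIso s :=
    inferInstanceAs (IsIso (Spec.map σ.toRingEquiv.symm.toCommRingCatIso.hom))
  have : IsIso g := hg.isIso_fst_of_isIso
  exact ⟨asIso g, pullback.lift_snd _ _ _⟩
end

section
/- Let k be a flexible field of characteristic zero and q a nonzero anisotropic quadratic form over k. Then there exist a natural number r ≥ 1, elements a₁,…,a_r ∈ k*, a scalar c ∈ k*, and a quadratic form q' over k such that the r-fold Pfister form π = ⟨⟨a₁,…,a_r⟩⟩ is anisotropic and π is isometric to the orthogonal sum (c·q) ⊥ q'; that is, every anisotropic quadratic form over a flexible field is, up to a scalar multiple, a subform of an anisotropic Pfister form defined over k itself. -/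
universe u

/-- The `r`-fold Pfister form `⟨⟨a₁,…,a_r⟩⟩ = ⟨1,−a₁⟩ ⊗ ⋯ ⊗ ⟨1,−a_r⟩` over `k`, written in its
standard diagonalization: the `2^r`-dimensional diagonal quadratic form whose entry at a subset
`S ⊆ {1,…,r}` is `∏_{i ∈ S} (−a_i)`. -/
noncomputable def PfisterForm (k : Type u) [Field k] {r : ℕ} (a : Fin r → k) :
    QuadraticForm k (Finset (Fin r) → k) :=
  QuadraticMap.weightedSumSquares k fun S : Finset (Fin r) => ∏ i ∈ S, (-a i)

/-- The diagonal form with weights `d` over `k` has no nontrivial zero with coordinates in `F`. -/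
def AnisotropicOn {k ι : Type*} [Field k] [Fintype ι] (F : Set k) (d : ι → k) : Prop :=
  ∀ x : ι → k, (∀ i, x i ∈ F) → ∑ i, d i * x i ^ 2 = 0 → x = 0

section CasselsPfister

open Polynomial

variable {K ι : Type*} [Field K] [Fintype ι] {d : ι → K}

theorem coeff_sum_C_mul_sq (d : ι → K) {p : ι → K[X]} {N : ℕ} (hp : ∀ i, (p i).natDegree ≤ N) :
    (∑ i, C (d i) * p i ^ 2).coeff (2 * N) = ∑ i, d i * (p i).coeff N ^ 2 := by
  rw [finsetSum_coeff]
  refine Finset.sum_congr rfl fun i _ => ?_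
  rw [coeff_C_mul, coeff_pow_of_natDegree_le (hp i)]

theorem natDegree_le_of_natDegree_sum_C_mul_sq_le (hd : AnisotropicOn Set.univ d)
    {p : ι → K[X]} {M : ℕ} (h : (∑ i, C (d i) * p i ^ 2).natDegree ≤ 2 * M) (i : ι) :
    (p i).natDegree ≤ M := by
  suffices H : ∀ N, (∀ i, (p i).natDegree ≤ M + N) → ∀ i, (p i).natDegree ≤ M from
    H (∑ j, (p j).natDegree) (fun j => (Finset.single_le_sum
      (f := fun j => (p j).natDegree) (fun _ _ => Nat.zero_le _) (Finset.mem_univ j)).trans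
      (Nat.le_add_left _ _)) i
  intro N
  induction N with
  | zero => exact fun h => h
  | succ N ih =>
    intro hN
    apply ih
    have h0 := coeff_sum_C_mul_sq d hN
    rw [coeff_eq_zero_of_natDegree_lt (by omega)] at h0
    have h1 := hd (fun i => (p i).coeff (M + (N + 1))) (fun _ => trivial) h0.symm
    exact fun j => natDegree_le_pred (hN j) (congrFun h1 j)

theorem eq_zero_of_sum_C_mul_sq_eq_zero (hd : AnisotropicOn Set.univ d)
    {p : ι → K[X]} (h : ∑ i, C (d i) * p i ^ 2 = 0) : p = 0 := by
  have h0 := natDegree_le_of_natDegree_sum_C_mul_sq_le hd (p := p) (M := 0) (by simp [h])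
  have h1 := coeff_sum_C_mul_sq d h0
  rw [h, coeff_zero] at h1
  have h2 := hd (fun i => (p i).coeff 0) (fun _ => trivial) (by simpa using h1.symm)
  funext i
  rw [eq_C_of_natDegree_le_zero (h0 i)]
  simpa using congrFun h2 i

/-- **Cassels–Pfister theorem** for diagonal forms. -/
theorem exists_polynomial_of_sum_C_mul_sq_eq (hd : AnisotropicOn Set.univ d)
    {f g : K[X]} {p : ι → K[X]} (hg : g ≠ 0) (h : ∑ i, C (d i) * p i ^ 2 = g ^ 2 * f) :
    ∃ p' : ι → K[X], ∑ i, C (d i) * p' i ^ 2 = f := by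
  induction hn : g.natDegree using Nat.strong_induction_on generalizing g p with
  | _ n ih =>
  subst hn
  set v : ι → K[X] := fun i => p i / g with hv
  set r : ι → K[X] := fun i => p i % g with hr
  have hpr : ∀ i, p i = g * v i + r i := fun i => (EuclideanDomain.div_add_mod _ _).symm
  by_cases hr0 : r = 0
  · refine ⟨v, mul_left_cancel₀ (pow_ne_zero 2 hg) ?_⟩
    rw [← h, Finset.mul_sum]
    refine Finset.sum_congr rfl fun i _ => ?_
    rw [hpr i, hr0]
    simp only [Pi.zero_apply]
    ring
  set φv := ∑ i, C (d i) * v i ^ 2 with hφv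
  set φr := ∑ i, C (d i) * r i ^ 2 with hφr
  set β := ∑ i, C (d i) * (v i * r i) with hβ
  have hφr0 : φr ≠ 0 := fun h0 => hr0 (eq_zero_of_sum_C_mul_sq_eq_zero hd h0)
  have hexp : g ^ 2 * φv + 2 * g * β + φr = g ^ 2 * f := by
    rw [← h, hφv, hφr, hβ, Finset.mul_sum, Finset.mul_sum, ← Finset.sum_add_distrib,
      ← Finset.sum_add_distrib]
    refine Finset.sum_congr rfl fun i _ => ?_
    rw [hpr i]
    ring
  set s := g * f - g * φv - 2 * β with hs
  have hφs : φr = g * s := by rw [hs]; linear_combination hexp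
  have hs0 : s ≠ 0 := fun h0 => hφr0 (by rw [hφs, h0, mul_zero])
  have hdeg : s.natDegree < g.natDegree := by
    have hgdeg : g.natDegree ≠ 0 := by
      intro h0
      apply hr0
      funext i
      have hu : IsUnit g := isUnit_iff_degree_eq_zero.2 (by rw [degree_eq_natDegree hg, h0]; rfl)
      exact EuclideanDomain.mod_eq_zero.2 hu.dvd
    have hri : ∀ i, (r i).natDegree ≤ g.natDegree - 1 := fun i =>
      Nat.le_sub_one_of_lt (natDegree_mod_lt _ hgdeg)
    have : φr.natDegree ≤ 2 * (g.natDegree - 1) := by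
      refine natDegree_sum_le_of_forall_le _ _ fun i _ => ?_
      refine (natDegree_C_mul_le _ _).trans (natDegree_pow_le.trans ?_)
      exact Nat.mul_le_mul_left _ (hri i)
    rw [hφs, natDegree_mul hg hs0] at this
    omega
  refine ih _ hdeg (g := s) (p := fun i => s * v i + (φv - f) * r i) hs0 ?_ rfl
  have : ∑ i, C (d i) * (s * v i + (φv - f) * r i) ^ 2
      = s ^ 2 * φv + 2 * s * (φv - f) * β + (φv - f) ^ 2 * φr := by
    rw [hφv, hφr, hβ, Finset.mul_sum, Finset.mul_sum, Finset.mul_sum, ← Finset.sum_add_distrib,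
      ← Finset.sum_add_distrib]
    refine Finset.sum_congr rfl fun i _ => ?_
    ring
  rw [this, hφs, hs]
  ring

/-- **Cassels' descent**: if `⟨c⟩ ⊥ ⟨d₁,…,dₙ⟩` is anisotropic over `K` and represents `c X² + e`
over `K(X)`, then `⟨d₁,…,dₙ⟩` represents `e` over `K`. -/
theorem exists_sum_mul_sq_eq_of_polynomial (h2 : (2 : K) ≠ 0) {c e : K}
    (hd : AnisotropicOn Set.univ (fun o : Option ι => o.elim c d))
    {g p₀ : K[X]} {p : ι → K[X]} (hg : g ≠ 0)
    (h : C c * p₀ ^ 2 + ∑ i, C (d i) * p i ^ 2 = g ^ 2 * (C c * X ^ 2 + C e)) :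
    ∃ x : ι → K, ∑ i, d i * x i ^ 2 = e := by
  obtain ⟨q, hq⟩ := exists_polynomial_of_sum_C_mul_sq_eq hd (p := fun o => o.elim p₀ p) hg
    (f := C c * X ^ 2 + C e) (by rw [Fintype.sum_option]; exact h)
  have hdeg : (q none).natDegree ≤ 1 :=
    natDegree_le_of_natDegree_sum_C_mul_sq_le hd (by rw [hq]; compute_degree) none
  obtain ⟨β, α, hαβ⟩ := exists_eq_X_add_C_of_natDegree_le_one hdeg
  obtain ⟨z, hz⟩ : ∃ z, (β * z + α) ^ 2 = z ^ 2 := by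
    by_cases hβ : β = 1
    · refine ⟨-α / 2, ?_⟩
      subst hβ
      field_simp
      ring
    · have : 1 - β ≠ 0 := sub_ne_zero.2 (Ne.symm hβ)
      refine ⟨α / (1 - β), ?_⟩
      field_simp
      ring
  refine ⟨fun i => (q (some i)).eval z, ?_⟩
  have := congrArg (eval z) hq
  rw [Fintype.sum_option, hαβ] at this
  simp only [Option.elim, eval_add, eval_mul, eval_C, eval_pow, eval_X, eval_finsetSum, hz] at this
  linear_combination this

end CasselsPfister

section SimpleTranscendental

open Polynomial IntermediateField

variable {K k ι : Type*} [Field K] [Field k] [Algebra K k] [Fintype ι] {z : k}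

theorem exists_common_denominator_of_mem_adjoin_simple {x : ι → k} (hx : ∀ i, x i ∈ K⟮z⟯) :
    ∃ (g : K[X]) (p : ι → K[X]), aeval z g ≠ 0 ∧ ∀ i, aeval z (p i) = aeval z g * x i := by
  classical
  have H : ∀ i, ∃ g p : K[X], aeval z g ≠ 0 ∧ aeval z p = aeval z g * x i := by
    intro i
    obtain ⟨r, s, hrs⟩ := (mem_adjoin_simple_iff K _).1 (hx i)
    by_cases hs : aeval z s = 0
    · exact ⟨1, 0, by simp, by simp [hrs, hs]⟩
    · exact ⟨s, r, hs, by rw [hrs, mul_div_cancel₀ _ hs]⟩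
  choose g p hg hp using H
  refine ⟨∏ i, g i, fun i => p i * ∏ j ∈ Finset.univ.erase i, g j, ?_, fun i => ?_⟩
  · rw [map_prod]
    exact Finset.prod_ne_zero_iff.2 fun i _ => hg i
  · rw [← Finset.mul_prod_erase _ _ (Finset.mem_univ i), map_mul, map_mul, hp]
    ring

/-- Anisotropy is preserved under simple transcendental extensions. -/
theorem AnisotropicOn.adjoin_simple (hz : Transcendental K z) {d : ι → K}
    (hd : AnisotropicOn Set.univ d) :
    AnisotropicOn (K⟮z⟯ : Set k) fun i => algebraMap K k (d i) := by
  intro x hx h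
  obtain ⟨g, p, hg, hp⟩ := exists_common_denominator_of_mem_adjoin_simple hx
  have h0 : ∑ i, C (d i) * p i ^ 2 = 0 := by
    refine transcendental_iff_injective.1 hz ?_
    rw [map_zero, map_sum]
    calc _ = aeval z g ^ 2 * ∑ i, algebraMap K k (d i) * x i ^ 2 := by
          rw [Finset.mul_sum]
          refine Finset.sum_congr rfl fun i _ => ?_
          rw [map_mul, map_pow, hp, aeval_C]
          ring
      _ = 0 := by rw [h, mul_zero]
  have hp0 := eq_zero_of_sum_C_mul_sq_eq_zero hd h0
  funext i
  have := hp i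
  rw [hp0, Pi.zero_apply, map_zero] at this
  exact (mul_eq_zero.1 this.symm).resolve_left hg

theorem exists_sum_mul_sq_eq_of_adjoin_simple (h2 : (2 : K) ≠ 0) (hz : Transcendental K z)
    {d : ι → K} {c e : K} (hd : AnisotropicOn Set.univ (fun o : Option ι => o.elim c d))
    {y : Option ι → k} (hy : ∀ o, y o ∈ K⟮z⟯)
    (h : algebraMap K k c * y none ^ 2 + ∑ i, algebraMap K k (d i) * y (some i) ^ 2
      = algebraMap K k c * z ^ 2 + algebraMap K k e) :
    ∃ x : ι → K, ∑ i, d i * x i ^ 2 = e := by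
  obtain ⟨g, p, hg, hp⟩ := exists_common_denominator_of_mem_adjoin_simple hy
  have hg0 : g ≠ 0 := by rintro rfl; simp at hg
  refine exists_sum_mul_sq_eq_of_polynomial h2 hd hg0 (p₀ := p none) (p := fun i => p (some i)) ?_
  refine transcendental_iff_injective.1 hz ?_
  calc _ = aeval z g ^ 2 * (algebraMap K k c * y none ^ 2 +
          ∑ i, algebraMap K k (d i) * y (some i) ^ 2) := by
        rw [map_add, map_sum, mul_add, Finset.mul_sum]
        congr 1
        · rw [map_mul, map_pow, hp, aeval_C]
          ring
        · refine Finset.sum_congr rfl fun i _ => ?_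
          rw [map_mul, map_pow, hp, aeval_C]
          ring
    _ = _ := by
        rw [h]
        simp

end SimpleTranscendental

section Tower

open IntermediateField

variable {E k ι : Type*} [Field E] [Field k] [Algebra E k] [Fintype ι] {t : ℕ → k}

theorem AnisotropicOn.mono {F G : Set k} (hFG : F ⊆ G) {d : ι → k} (hd : AnisotropicOn G d) :
    AnisotropicOn F d :=
  fun x hx h => hd x (fun i => hFG (hx i)) h

theorem AnisotropicOn.ne_zero {d : ι → k} (hd : AnisotropicOn Set.univ d) (i : ι) : d i ≠ 0 := by
  classical
  intro h
  have := hd (Pi.single i 1) (fun _ => trivial) (by simp [Pi.single_apply, h])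
  simpa using congrFun this i

theorem AnisotropicOn.comp_injective {ι' : Type*} [Fintype ι'] {d : ι → k}
    (hd : AnisotropicOn Set.univ d) {f : ι' → ι} (hf : Function.Injective f) :
    AnisotropicOn Set.univ (d ∘ f) := by
  classical
  intro x _ h
  have := hd (Function.extend f x 0) (fun _ => trivial) (by
    rw [← h]
    refine (Fintype.sum_of_injective f hf _ _ (fun i hi => ?_) fun i => ?_).symm
    · rw [Function.extend_apply' _ _ _ (by simpa using hi)]
      simp
    · simp [hf.extend_apply])
  funext i
  simpa [hf.extend_apply] using congrFun this (f i)

theorem anisotropicOn_intermediateField_iff {F : IntermediateField E k} {d : ι → F} :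
    AnisotropicOn (F : Set k) (fun i => (d i : k)) ↔ AnisotropicOn Set.univ d := by
  refine ⟨fun hd x _ h => ?_, fun hd x hx h => ?_⟩
  · have := hd (fun i => x i) (fun i => (x i).2) (by
      simpa using congrArg (algebraMap F k) h)
    funext i
    exact Subtype.ext (congrFun this i)
  · lift x to ι → F using hx
    have := hd x (fun _ => trivial) (Subtype.ext (by simpa using h))
    simp [this]
    rfl

variable (E t) in
/-- The subextension of `k / E` generated by `t 0, …, t (m - 1)`. -/
def towerLevel (m : ℕ) : IntermediateField E k :=
  adjoin E (t '' Set.Iio m)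

theorem towerLevel_mono : Monotone (towerLevel E t) := fun _ _ h =>
  adjoin.mono _ _ _ (Set.image_mono (Set.Iio_subset_Iio h))

theorem mem_towerLevel {i m : ℕ} (h : i < m) : t i ∈ towerLevel E t m :=
  subset_adjoin _ _ ⟨i, h, rfl⟩

theorem towerLevel_succ (m : ℕ) :
    towerLevel E t (m + 1) = ((towerLevel E t m)⟮t m⟯).restrictScalars E := by
  rw [towerLevel, towerLevel, adjoin_adjoin_left]
  congr 1
  ext x
  simp only [Set.mem_image, Set.mem_Iio, Set.mem_union, Set.mem_singleton_iff,
    Nat.lt_succ_iff_lt_or_eq]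
  aesop

theorem exists_forall_mem_towerLevel {κ : Type*} [Finite κ] (ht : adjoin E (Set.range t) = ⊤)
    (m₀ : ℕ) (x : κ → k) : ∃ m, m₀ ≤ m ∧ ∀ i, x i ∈ towerLevel E t m := by
  classical
  have H : ∀ y : k, ∃ m, y ∈ towerLevel E t m := by
    intro y
    obtain ⟨T, hT, hy⟩ := exists_finset_of_mem_adjoin (F := E) (S := Set.range t) (x := y)
      (by rw [ht]; trivial)
    choose! g hg using fun (a : k) (ha : a ∈ T) => hT ha
    refine ⟨T.sup g + 1, adjoin.mono _ _ _ (fun a ha => ?_) hy⟩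
    exact ⟨g a, Nat.lt_succ_iff.2 (Finset.le_sup ha), hg a ha⟩
  choose m hm using fun i => H (x i)
  have := Fintype.ofFinite κ
  exact ⟨max m₀ (Finset.univ.sup m), le_max_left _ _, fun i =>
    towerLevel_mono ((Finset.le_sup (Finset.mem_univ i)).trans (le_max_right _ _)) (hm i)⟩

theorem transcendental_towerLevel (ht : AlgebraicIndependent E t) (m : ℕ) :
    Transcendental (towerLevel E t m) (t m) := by
  rw [Transcendental, towerLevel, isAlgebraic_adjoin_iff]
  exact ht.transcendental_adjoin (s := Set.Iio m) (i := m) (by simp)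

theorem AnisotropicOn.towerLevel_succ (ht : AlgebraicIndependent E t) {m : ℕ} {d : ι → k}
    (hm : ∀ i, d i ∈ towerLevel E t m) (hd : AnisotropicOn (towerLevel E t m : Set k) d) :
    AnisotropicOn (towerLevel E t (m + 1) : Set k) d := by
  lift d to ι → towerLevel E t m using hm
  rw [_root_.towerLevel_succ]
  exact (anisotropicOn_intermediateField_iff.1 hd).adjoin_simple (transcendental_towerLevel ht m)

theorem AnisotropicOn.of_towerLevel (ht : AlgebraicIndependent E t)
    (htop : adjoin E (Set.range t) = ⊤) {m : ℕ} {d : ι → k}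
    (hm : ∀ i, d i ∈ towerLevel E t m) (hd : AnisotropicOn (towerLevel E t m : Set k) d) :
    AnisotropicOn Set.univ d := by
  intro x _ h
  obtain ⟨n, hmn, hx⟩ := exists_forall_mem_towerLevel htop m x
  have : AnisotropicOn (towerLevel E t n : Set k) d := by
    induction n, hmn using Nat.le_induction generalizing x with
    | base => exact hd
    | succ n hmn ih =>
      refine AnisotropicOn.towerLevel_succ ht (fun i => towerLevel_mono hmn (hm i)) ?_
      intro y hy h'
      exact ih y (fun _ => trivial) h' hy y hy h'
  exact this x hx h

/-- Descent of a representation of the generic value of a subform. -/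
theorem exists_sum_mul_sq_eq_of_towerLevel [CharZero k] (ht : AlgebraicIndependent E t)
    {m : ℕ} {e : k} (he : e ∈ towerLevel E t m) {b : ι → k} (hb : ∀ i, b i ∈ towerLevel E t m)
    {s : ℕ} {D : Fin s → k} (hD : ∀ j, D j ∈ towerLevel E t m)
    (han : AnisotropicOn Set.univ (Sum.elim b D)) {x : ι ⊕ Fin s → k}
    (hx : ∀ j, x j ∈ towerLevel E t (m + s))
    (h : ∑ j, Sum.elim b D j * x j ^ 2 = ∑ j, D j * t (m + j) ^ 2 + e) :
    ∃ y : ι → k, (∀ i, y i ∈ towerLevel E t m) ∧ ∑ i, b i * y i ^ 2 = e := by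
  induction s with
  | zero =>
    refine ⟨fun i => x (Sum.inl i), fun i => hx _, ?_⟩
    simpa using h
  | succ s ih =>
    have hle : towerLevel E t m ≤ towerLevel E t (m + s) := towerLevel_mono (Nat.le_add_right _ _)
    set F := towerLevel E t (m + s) with hF
    let d : ι ⊕ Fin s → F := Sum.elim (fun i => ⟨b i, hle (hb i)⟩)
      (fun j => ⟨D j.castSucc, hle (hD _)⟩)
    let c : F := ⟨D (Fin.last s), hle (hD _)⟩
    let e' : F := ⟨∑ j : Fin s, D j.castSucc * t (m + j) ^ 2 + e,
      add_mem (sum_mem fun j _ => mul_mem (hle (hD _))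
        (pow_mem (mem_towerLevel (Nat.add_lt_add_left j.2 m)) 2)) (hle he)⟩
    have h2 : (2 : F) ≠ 0 := fun h0 =>
      two_ne_zero (congrArg (algebraMap F k) h0)
    have hd : AnisotropicOn Set.univ (fun o : Option (ι ⊕ Fin s) => o.elim c d) := by
      let f : Option (ι ⊕ Fin s) → ι ⊕ Fin (s + 1) :=
        fun o => o.elim (Sum.inr (Fin.last s)) (Sum.map id Fin.castSucc)
      have hf : Function.Injective f := by
        rintro (_ | i | i) (_ | j | j) <;>
          simp [f, Fin.castSucc_ne_last, (Fin.castSucc_ne_last _).symm]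
      intro y _ hy
      have := han.comp_injective hf (fun i => y i) (fun _ => trivial) (by
        have := congrArg (algebraMap F k) hy
        rw [map_sum, map_zero] at this
        rw [← this]
        refine Finset.sum_congr rfl fun o _ => ?_
        rcases o with (_ | i | i) <;> simp [f, c, d])
      funext i
      exact Subtype.ext (congrFun this i)
    obtain ⟨y, hy⟩ := exists_sum_mul_sq_eq_of_adjoin_simple h2
      (transcendental_towerLevel ht (m + s)) (d := d) (c := c) (e := e') hd
      (y := fun o => x (o.elim (Sum.inr (Fin.last s)) (Sum.map id Fin.castSucc))) (fun o => by
        have := hx (o.elim (Sum.inr (Fin.last s)) (Sum.map id Fin.castSucc))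
        rw [← add_assoc, towerLevel_succ] at this
        exact this) (by
        rw [Fintype.sum_sum_type, Fin.sum_univ_castSucc, Fin.sum_univ_castSucc] at h
        rw [Fintype.sum_sum_type]
        simp [d, c, e'] at h ⊢
        linear_combination h)
    refine ih (D := fun j => D j.castSucc) (fun j => hD _) ?_ (x := fun j => y j)
      (fun j => (y j).2) ?_
    · have := han.comp_injective (f := Sum.map id Fin.castSucc)
        (Function.injective_id.sumMap (Fin.castSucc_injective s))
      convert this using 1
      ext (i | i) <;> rfl
    · have := congrArg (algebraMap F k) hy
      rw [map_sum] at this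
      refine Eq.trans (Finset.sum_congr rfl fun o _ => ?_) this
      rcases o with i | i <;> simp [d]

end Tower

section Pfister

open scoped Classical in
/-- Subsets of `Fin (r + 1)` are subsets of `Fin r`, with or without the new element `0`. -/
noncomputable def finsetFinSuccEquiv (r : ℕ) :
    Finset (Fin r) ⊕ Finset (Fin r) ≃ Finset (Fin (r + 1)) where
  toFun := Sum.elim (fun S => S.map (Fin.succEmb r)) (fun S => insert 0 (S.map (Fin.succEmb r)))
  invFun T := if 0 ∈ T then Sum.inr ({i | i.succ ∈ T} : Finset (Fin r))
    else Sum.inl ({i | i.succ ∈ T} : Finset (Fin r))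
  left_inv := by
    rintro (S | S) <;> simp [Fin.succ_ne_zero]
  right_inv T := by
    by_cases h : 0 ∈ T <;> simp only [h, if_true, if_false] <;> ext i <;>
      refine Fin.cases ?_ (fun j => ?_) i <;> simp [h, Fin.succ_ne_zero]

/-- The diagonal entries of the Pfister form `⟨⟨a₁,…,a_r⟩⟩`. -/
def pfisterWeight {k : Type*} [Field k] {r : ℕ} (a : Fin r → k) (S : Finset (Fin r)) : k :=
  ∏ i ∈ S, (-a i)

variable {k : Type*} [Field k] {r : ℕ} {a : Fin r → k}

@[simp] theorem pfisterWeight_empty : pfisterWeight a ∅ = 1 := Finset.prod_empty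

theorem pfisterWeight_cons_inl (y : k) (S : Finset (Fin r)) :
    pfisterWeight (Fin.cons y a : Fin (r + 1) → k) (finsetFinSuccEquiv r (Sum.inl S))
      = pfisterWeight a S := by
  simp [finsetFinSuccEquiv, pfisterWeight]

theorem pfisterWeight_cons_inr (y : k) (S : Finset (Fin r)) :
    pfisterWeight (Fin.cons y a : Fin (r + 1) → k) (finsetFinSuccEquiv r (Sum.inr S))
      = -y * pfisterWeight a S := by
  simp [finsetFinSuccEquiv, pfisterWeight, Finset.prod_insert]

theorem sum_pfisterWeight_cons_mul (y : k) (f : Finset (Fin (r + 1)) → k) :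
    ∑ T, pfisterWeight (Fin.cons y a : Fin (r + 1) → k) T * f T
      = ∑ S, pfisterWeight a S * f (finsetFinSuccEquiv r (Sum.inl S))
        - y * ∑ S, pfisterWeight a S * f (finsetFinSuccEquiv r (Sum.inr S)) := by
  rw [← (finsetFinSuccEquiv r).sum_comp, Fintype.sum_sum_type, Finset.mul_sum, sub_eq_add_neg,
    ← Finset.sum_neg_distrib]
  congr 1 <;> refine Finset.sum_congr rfl fun S _ => ?_
  · rw [pfisterWeight_cons_inl]
  · rw [pfisterWeight_cons_inr]
    ring

/-- The value of the Pfister form `⟨⟨a₁,…,a_r⟩⟩` at `u`. -/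
def pfisterValue (a : Fin r → k) (u : Finset (Fin r) → k) : k :=
  ∑ S, pfisterWeight a S * u S ^ 2

theorem pfisterValue_smul (c : k) (u : Finset (Fin r) → k) :
    pfisterValue a (c • u) = c ^ 2 * pfisterValue a u := by
  rw [pfisterValue, pfisterValue, Finset.mul_sum]
  refine Finset.sum_congr rfl fun S _ => ?_
  rw [Pi.smul_apply, smul_eq_mul]
  ring

theorem pfisterValue_add_smul (c : k) (u v : Finset (Fin r) → k) :
    pfisterValue a (u + c • v) = pfisterValue a u +
      2 * c * ∑ S, pfisterWeight a S * (u S * v S) + c ^ 2 * pfisterValue a v := by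
  simp only [pfisterValue, Finset.mul_sum, ← Finset.sum_add_distrib]
  refine Finset.sum_congr rfl fun S _ => ?_
  rw [Pi.add_apply, Pi.smul_apply, smul_eq_mul]
  ring

theorem pfisterValue_cons (y : k) (u : Finset (Fin (r + 1)) → k) :
    pfisterValue (Fin.cons y a : Fin (r + 1) → k) u
      = pfisterValue a (fun S => u (finsetFinSuccEquiv r (Sum.inl S)))
        - y * pfisterValue a (fun S => u (finsetFinSuccEquiv r (Sum.inr S))) :=
  sum_pfisterWeight_cons_mul y _

/-- The vector `(u₁, u₂)` of the space of `⟨⟨y,a₁,…,a_r⟩⟩ = ⟨⟨a₁,…,a_r⟩⟩ ⊥ -y⟨⟨a₁,…,a_r⟩⟩`. -/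
noncomputable def pfisterPair {k : Type*} {r : ℕ} (u₁ u₂ : Finset (Fin r) → k)
    (T : Finset (Fin (r + 1))) : k :=
  Sum.elim u₁ u₂ ((finsetFinSuccEquiv r).symm T)

theorem pfisterValue_cons_pfisterPair (y : k) (u₁ u₂ : Finset (Fin r) → k) :
    pfisterValue (Fin.cons y a : Fin (r + 1) → k) (pfisterPair u₁ u₂)
      = pfisterValue a u₁ - y * pfisterValue a u₂ := by
  rw [pfisterValue_cons]
  simp [pfisterPair]

theorem sum_pfisterWeight_cons_mul_pfisterPair (y : k) (u₁ u₂ v₁ v₂ : Finset (Fin r) → k) :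
    ∑ T, pfisterWeight (Fin.cons y a : Fin (r + 1) → k) T *
        (pfisterPair u₁ u₂ T * pfisterPair v₁ v₂ T)
      = ∑ S, pfisterWeight a S * (u₁ S * v₁ S) - y * ∑ S, pfisterWeight a S * (u₂ S * v₂ S) := by
  rw [sum_pfisterWeight_cons_mul]
  simp [pfisterPair]

theorem pfisterPair_mem {k : Type*} {F : Set k} {u₁ u₂ : Finset (Fin r) → k} (h₁ : ∀ S, u₁ S ∈ F)
    (h₂ : ∀ S, u₂ S ∈ F) (T : Finset (Fin (r + 1))) : pfisterPair u₁ u₂ T ∈ F := by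
  rw [pfisterPair]
  rcases (finsetFinSuccEquiv r).symm T with S | S
  · exact h₁ S
  · exact h₂ S

theorem map_pfisterWeight {L : Type*} [Field L] (f : k →+* L) (a : Fin r → k)
    (S : Finset (Fin r)) : f (pfisterWeight a S) = pfisterWeight (fun i => f (a i)) S := by
  simp [pfisterWeight]

theorem map_pfisterValue {L : Type*} [Field L] (f : k →+* L) (a : Fin r → k)
    (u : Finset (Fin r) → k) :
    f (pfisterValue a u) = pfisterValue (fun i => f (a i)) fun S => f (u S) := by
  simp [pfisterValue, map_pfisterWeight]

/-- Pfister forms are multiplicative: the product of two values is again a value. -/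
theorem exists_pfisterValue_eq_mul (a : Fin r → k) (u w : Finset (Fin r) → k) :
    ∃ x, pfisterValue a x = pfisterValue a u * pfisterValue a w := by
  induction r with
  | zero =>
    refine ⟨u * w, ?_⟩
    simp only [pfisterValue, Finset.univ_unique, Finset.sum_singleton, Pi.mul_apply]
    have : (default : Finset (Fin 0)) = ∅ := rfl
    rw [this, pfisterWeight_empty]
    ring
  | succ r ih =>
    obtain ⟨y, a, rfl⟩ : ∃ (y : k) (a' : Fin r → k), a = Fin.cons y a' :=
      ⟨a 0, Fin.tail a, (Fin.cons_self_tail a).symm⟩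
    rw [pfisterValue_cons, pfisterValue_cons]
    set u₁ := fun S => u (finsetFinSuccEquiv r (Sum.inl S))
    set u₂ := fun S => u (finsetFinSuccEquiv r (Sum.inr S))
    set w₁ := fun S => w (finsetFinSuccEquiv r (Sum.inl S))
    set w₂ := fun S => w (finsetFinSuccEquiv r (Sum.inr S))
    by_cases h₁ : pfisterValue a u₁ = 0
    · obtain ⟨x₁, hx₁⟩ := ih a u₂ w₂
      obtain ⟨x₂, hx₂⟩ := ih a u₂ w₁
      have hx := pfisterValue_cons_pfisterPair (a := a) y (y • x₁) x₂
      refine ⟨_, hx.trans ?_⟩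
      rw [pfisterValue_smul, hx₁, hx₂, h₁]
      ring
    by_cases h₂ : pfisterValue a u₂ = 0
    · obtain ⟨x₁, hx₁⟩ := ih a u₁ w₁
      obtain ⟨x₂, hx₂⟩ := ih a u₁ w₂
      have hx := pfisterValue_cons_pfisterPair (a := a) y x₁ x₂
      refine ⟨_, hx.trans ?_⟩
      rw [hx₁, hx₂, h₂]
      ring
    set c₁ := pfisterValue a u₁
    set c₂ := pfisterValue a u₂
    obtain ⟨v₀, hv₀⟩ := ih a u₂ w₂
    obtain ⟨v, hv⟩ := ih a u₁ v₀
    obtain ⟨x₁, hx₁⟩ := ih a u₁ (w₁ + (y * c₂ / c₁ / c₂) • v)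
    obtain ⟨x₂, hx₂⟩ := ih a u₂ (w₁ + (1 / c₂) • v)
    have hx := pfisterValue_cons_pfisterPair (a := a) y x₁ x₂
    refine ⟨_, hx.trans ?_⟩
    rw [hx₁, hx₂, pfisterValue_add_smul, pfisterValue_add_smul, hv, hv₀]
    field_simp
    ring

theorem AnisotropicOn.pfisterWeight_cons (h : AnisotropicOn Set.univ (pfisterWeight a)) {y : k}
    (hy : ∀ x, pfisterValue a x ≠ y) :
    AnisotropicOn Set.univ (pfisterWeight (Fin.cons y a : Fin (r + 1) → k)) := by
  intro u _ hu
  change pfisterValue _ u = 0 at hu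
  rw [pfisterValue_cons] at hu
  set u₁ := fun S => u (finsetFinSuccEquiv r (Sum.inl S)) with hu₁
  set u₂ := fun S => u (finsetFinSuccEquiv r (Sum.inr S)) with hu₂
  have h₂ : pfisterValue a u₂ = 0 := by
    by_contra h₂
    obtain ⟨x, hx⟩ := exists_pfisterValue_eq_mul a u₁ u₂
    refine hy ((pfisterValue a u₂)⁻¹ • x) ?_
    rw [pfisterValue_smul, hx]
    field_simp
    linear_combination hu
  have h₁ : pfisterValue a u₁ = 0 := by simpa [h₂] using hu
  funext T
  obtain ⟨S | S, rfl⟩ := (finsetFinSuccEquiv r).surjective T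
  · exact congrFun (h u₁ (fun _ => trivial) h₁) S
  · exact congrFun (h u₂ (fun _ => trivial) h₂) S

end Pfister

section Completion

open QuadraticMap Module

variable {K V : Type*} [Field K] [CharZero K] [AddCommGroup V] [Module K V]

/-- Orthogonal families of nonzero vectors of an anisotropic form extend to orthogonal bases. -/
theorem QuadraticMap.Anisotropic.exists_isOrtho_basis_extending [FiniteDimensional K V]
    {Q : QuadraticForm K V} (hQ : Q.Anisotropic) {ι : Type*} {v : ι → V}
    (hv : (associated (R := K) Q).IsOrthoᵢ v) (hne : ∀ i, v i ≠ 0) :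
    ∃ (s : ℕ) (B : Basis (ι ⊕ Fin s) K V), (∀ i, B (Sum.inl i) = v i) ∧
      (associated (R := K) Q).IsOrthoᵢ B := by
  set A : LinearMap.BilinForm K V := associated (R := K) Q
  have hself : ∀ x, A x x = Q x := fun x => associated_eq_self_apply K Q x
  have hsymm : A.IsSymm := ⟨associated_isSymm K Q⟩
  have hli : LinearIndependent K v :=
    LinearMap.linearIndependent_of_isOrthoᵢ hv fun i hi =>
      hne i (hQ _ (by rw [← hself]; exact hi))
  set W := Submodule.span K (Set.range v)
  have hW : IsCompl W (A.orthogonal W) := by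
    rw [LinearMap.BilinForm.isCompl_orthogonal_iff_disjoint hsymm.isRefl, Submodule.disjoint_def]
    intro x hx hx'
    exact hQ _ (by rw [← hself]; exact hx' x hx)
  obtain ⟨w, hw⟩ := LinearMap.BilinForm.exists_orthogonal_basis
    (LinearMap.BilinForm.isSymm_iff.1 (hsymm.restrict (A.orthogonal W)))
  have hvW : ∀ i, v i ∈ W := fun i => Submodule.subset_span ⟨i, rfl⟩
  refine ⟨_, ((Basis.span hli).prod w).map (Submodule.prodEquivOfIsCompl _ _ hW), fun i => ?_, ?_⟩
  · simp [Basis.span_apply]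
  · rw [LinearMap.isOrthoᵢ_def]
    rintro (i | i) (j | j) hij
    · simpa [Basis.span_apply] using hv (fun h => hij (by rw [h]))
    · simpa [Basis.span_apply] using (w j).2 _ (hvW i)
    · simpa [Basis.span_apply] using hsymm.isRefl _ _ ((w i).2 _ (hvW j))
    · simpa [Basis.span_apply] using hw (i := i) (j := j) (fun h => hij (by rw [h]))

/-- `QuadraticForm.isometryEquivWeightedSumSquares` for a basis with arbitrary index type. -/
theorem QuadraticMap.equivalent_weightedSumSquares_of_isOrtho {ι : Type*} [Fintype ι]
    (Q : QuadraticForm K V) (B : Basis ι K V) (hB : (associated (R := K) Q).IsOrthoᵢ B) :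
    Q.Equivalent (weightedSumSquares K fun i => Q (B i)) := by
  rw [← basisRepr_eq_of_iIsOrtho Q B hB]
  exact ⟨Q.isometryEquivBasisRepr B⟩

end Completion

section Diagonalization

open QuadraticMap Module

theorem sum_mul_sq_sum_eq {k ι κ : Type*} [Field k] [Fintype ι] [Fintype κ] {p : ι → k}
    {w : κ → ι → k} (hw : ∀ i j, i ≠ j → ∑ S, p S * (w i S * w j S) = 0) (x : κ → k) :
    ∑ S, p S * (∑ j, x j * w j S) ^ 2 = ∑ j, (∑ S, p S * w j S ^ 2) * x j ^ 2 := by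
  classical
  calc ∑ S, p S * (∑ j, x j * w j S) ^ 2
      = ∑ S, ∑ i, ∑ j, x i * x j * (p S * (w i S * w j S)) := by
        refine Finset.sum_congr rfl fun S _ => ?_
        rw [pow_two, Finset.sum_mul_sum, Finset.mul_sum]
        refine Finset.sum_congr rfl fun i _ => ?_
        rw [Finset.mul_sum]
        exact Finset.sum_congr rfl fun j _ => by ring
    _ = ∑ i, ∑ j, x i * x j * ∑ S, p S * (w i S * w j S) := by
        rw [Finset.sum_comm]
        refine Finset.sum_congr rfl fun i _ => ?_
        rw [Finset.sum_comm]
        exact Finset.sum_congr rfl fun j _ => (Finset.mul_sum _ _ _).symm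
    _ = _ := by
        refine Finset.sum_congr rfl fun i _ => ?_
        rw [Finset.sum_eq_single i (fun j _ hj => by rw [hw i j hj.symm, mul_zero])
          (fun h => absurd (Finset.mem_univ i) h), mul_comm, ← pow_two]
        exact congrArg (· * _) (Finset.sum_congr rfl fun S _ => by ring)

theorem anisotropic_weightedSumSquares_iff {k ι : Type*} [Field k] [Fintype ι] {d : ι → k} :
    (weightedSumSquares k d).Anisotropic ↔ AnisotropicOn Set.univ d := by
  simp only [Anisotropic, AnisotropicOn, weightedSumSquares_apply, smul_eq_mul, ← pow_two]
  exact ⟨fun h x _ => h x, fun h x => h x fun _ => trivial⟩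

variable {K ι κ : Type*} [Field K] [CharZero K] [Fintype ι]

theorem associated_weightedSumSquares_apply (p x y : ι → K) :
    associated (R := K) (weightedSumSquares K p) x y = ∑ i, p i * (x i * y i) := by
  refine mul_left_cancel₀ (two_ne_zero (α := K)) ?_
  have h := LinearMap.congr_fun₂ (two_nsmul_associated K (weightedSumSquares K p)) x y
  simp only [LinearMap.smul_apply, nsmul_eq_mul, Nat.cast_ofNat, polarBilin_apply_apply, polar,
    weightedSumSquares_apply, smul_eq_mul, Pi.add_apply, ← Finset.sum_sub_distrib] at h
  rw [h, Finset.mul_sum]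
  exact Finset.sum_congr rfl fun i _ => by ring

theorem AnisotropicOn.exists_diagonalization_extending [DecidableEq ι] [DecidableEq κ]
    [Fintype κ] {p : ι → K} (hp : AnisotropicOn Set.univ p) {v : κ → ι → K}
    (hv : ∀ i j, i ≠ j → ∑ S, p S * (v i S * v j S) = 0) (hne : ∀ i, v i ≠ 0) :
    ∃ (s : ℕ) (w : κ ⊕ Fin s → ι → K) (c : ι → κ ⊕ Fin s → K),
      (∀ i, w (Sum.inl i) = v i) ∧
      (∀ i j, i ≠ j → ∑ S, p S * (w i S * w j S) = 0) ∧
      (∀ S T, ∑ j, c S j * w j T = if S = T then 1 else 0) ∧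
      (∀ i j, ∑ S, w i S * c S j = if i = j then 1 else 0) := by
  obtain ⟨s, B, hBv, hB⟩ := (anisotropic_weightedSumSquares_iff.2 hp).exists_isOrtho_basis_extending
    (v := v) (fun i j hij => by
      simpa [associated_weightedSumSquares_apply] using hv i j hij) hne
  refine ⟨s, B, fun S j => B.repr (Pi.single S 1) j, hBv, fun i j hij => ?_, fun S T => ?_,
    fun i j => ?_⟩
  · simpa [associated_weightedSumSquares_apply] using hB hij
  · simpa [Pi.single_apply, eq_comm] using congrFun (B.sum_repr (Pi.single S 1)) T
  · have h1 : B i = ∑ S, B i S • (Pi.single S 1 : ι → K) := pi_eq_sum_univ' (B i)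
    have h2 := congrArg (fun x => B.repr x j) h1
    simp only [map_sum, map_smul, Basis.repr_self, Finsupp.single_apply, Finsupp.coe_finsetSum,
      Finset.sum_apply, Finsupp.smul_apply, smul_eq_mul] at h2
    exact h2.symm

end Diagonalization

section Induction

open IntermediateField

variable {E k : Type*} [Field E] [Field k] [CharZero k] [Algebra E k] {t : ℕ → k}

/-- If `w` is an orthogonal basis for `π = ⟨⟨a₁,…,a_r⟩⟩`, with dual coordinates `c`, extending
vectors of values `b`, and `⟨e⟩ ⊥ b` is anisotropic, then so is `⟨⟨y⟩⟩ ⊗ π`, where `y + e` is the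
generic value of the complement of `b` in `π`. -/
theorem AnisotropicOn.pfisterWeight_cons_generic (ht : AlgebraicIndependent E t)
    (htop : adjoin E (Set.range t) = ⊤) {r m : ℕ} {a : Fin r → k}
    (ha : ∀ i, a i ∈ towerLevel E t m) (han : AnisotropicOn Set.univ (pfisterWeight a))
    {n s : ℕ} {b : Fin n → k} {e : k} (he : e ∈ towerLevel E t m)
    (hbe : AnisotropicOn Set.univ (Fin.cons e b : Fin (n + 1) → k))
    {w : Fin n ⊕ Fin s → Finset (Fin r) → k} (hwm : ∀ j S, w j S ∈ towerLevel E t m)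
    {c : Finset (Fin r) → Fin n ⊕ Fin s → k} (hcm : ∀ S j, c S j ∈ towerLevel E t m)
    (hwb : ∀ i, pfisterValue a (w (Sum.inl i)) = b i)
    (hw : ∀ i j, i ≠ j → ∑ S, pfisterWeight a S * (w i S * w j S) = 0)
    (hcw : ∀ S T, ∑ j, c S j * w j T = if S = T then 1 else 0)
    (hwc : ∀ i j, ∑ S, w i S * c S j = if i = j then 1 else 0) :
    AnisotropicOn Set.univ (pfisterWeight (Fin.cons
      (∑ j : Fin s, pfisterValue a (w (Sum.inr j)) * t (m + j) ^ 2 - e) a : Fin (r + 1) → k)) := by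
  have hle : towerLevel E t m ≤ towerLevel E t (m + s) := towerLevel_mono (Nat.le_add_right _ _)
  have hwt : ∀ S, pfisterWeight a S ∈ towerLevel E t m := fun S =>
    prod_mem fun i _ => neg_mem (ha i)
  have hval : ∀ j, pfisterValue a (w j) ∈ towerLevel E t m := fun j =>
    sum_mem fun S _ => mul_mem (hwt S) (pow_mem (hwm j S) 2)
  have hsum : (fun j => pfisterValue a (w j))
      = Sum.elim b fun j => pfisterValue a (w (Sum.inr j)) := by
    ext (i | i)
    · exact hwb i
    · rfl
  set y := ∑ j : Fin s, pfisterValue a (w (Sum.inr j)) * t (m + j) ^ 2 - e with hy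
  have hym : y ∈ towerLevel E t (m + s) := sub_mem (sum_mem fun j _ => mul_mem (hle (hval _))
    (pow_mem (mem_towerLevel (Nat.add_lt_add_left j.2 m)) 2)) (hle he)
  have hD : AnisotropicOn Set.univ
      (Sum.elim b fun j => pfisterValue a (w (Sum.inr j))) := by
    intro x _ hx
    rw [← hsum] at hx
    have h0 := han _ (fun _ => trivial) ((sum_mul_sq_sum_eq hw x).trans hx)
    funext l
    calc x l = ∑ j, x j * ∑ S, w j S * c S l := by simp [hwc]
      _ = ∑ S, (∑ j, x j * w j S) * c S l := by
        simp only [Finset.mul_sum, Finset.sum_mul]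
        rw [Finset.sum_comm]
        exact Finset.sum_congr rfl fun S _ => Finset.sum_congr rfl fun j _ => by ring
      _ = 0 := Finset.sum_eq_zero fun S _ => by
        rw [show ∑ j, x j * w j S = 0 from congrFun h0 S, zero_mul]
  have hny : ∀ x : Finset (Fin r) → k, (∀ S, x S ∈ towerLevel E t (m + s)) →
      pfisterValue a x ≠ y := by
    intro x hx hxy
    have hxw : x = fun T => ∑ j, (∑ S, x S * c S j) * w j T := by
      funext T
      calc x T = ∑ S, x S * ∑ j, c S j * w j T := by simp [hcw]
        _ = _ := by
          simp only [Finset.mul_sum, Finset.sum_mul]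
          rw [Finset.sum_comm]
          exact Finset.sum_congr rfl fun S _ => Finset.sum_congr rfl fun j _ => by ring
    obtain ⟨z, -, hz⟩ := exists_sum_mul_sq_eq_of_towerLevel ht (neg_mem he)
      (fun i => hwb i ▸ hval _) (fun j => hval (Sum.inr j)) hD
      (x := fun j => ∑ S, x S * c S j)
      (fun j => sum_mem fun S _ => mul_mem (hx S) (hle (hcm S j))) (by
        rw [← sub_eq_add_neg, ← hy, ← hxy, ← hsum]
        refine (sum_mul_sq_sum_eq hw _).symm.trans ?_
        rw [pfisterValue]
        exact Finset.sum_congr rfl fun S _ => by rw [← congrFun hxw S])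
    have := hbe (Fin.cons 1 z) (fun _ => trivial) (by
      rw [Fin.sum_univ_succ]
      simp [hz])
    simpa using congrFun this 0
  refine AnisotropicOn.of_towerLevel ht htop (m := m + s)
    (fun S => prod_mem fun i _ => neg_mem ?_) ?_
  · refine Fin.cases ?_ (fun i => ?_) i
    · exact hym
    · exact hle (ha i)
  let F := towerLevel E t (m + s)
  let a' : Fin r → F := fun i => ⟨a i, hle (ha i)⟩
  have han' : AnisotropicOn Set.univ (pfisterWeight a') := by
    rw [← anisotropicOn_intermediateField_iff]
    have : (fun S => ((pfisterWeight a' S : F) : k)) = pfisterWeight a := by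
      funext S
      exact map_pfisterWeight (algebraMap F k) a' S
    rw [this]
    exact han.mono (Set.subset_univ _)
  have := han'.pfisterWeight_cons (y := ⟨y, hym⟩) fun x hx =>
    hny (fun S => x S) (fun S => (x S).2)
      ((map_pfisterValue (algebraMap F k) a' x).symm.trans (congrArg (algebraMap F k) hx))
  rw [← anisotropicOn_intermediateField_iff] at this
  convert this using 1
  funext S
  refine Eq.trans ?_ (map_pfisterWeight (algebraMap F k) _ S).symm
  congr 1
  funext i
  refine Fin.cases ?_ (fun i => ?_) i <;> rfl

/-- An anisotropic diagonal form `⟨b₁,…,bₙ⟩` is a subform of an anisotropic Pfister form. -/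
theorem AnisotropicOn.exists_pfister (ht : AlgebraicIndependent E t)
    (htop : adjoin E (Set.range t) = ⊤) {n : ℕ} {b : Fin n → k} (hb : AnisotropicOn Set.univ b)
    {m₀ : ℕ} (hbm : ∀ i, b i ∈ towerLevel E t m₀) :
    ∃ (m r : ℕ) (a : Fin r → k) (v : Fin n → Finset (Fin r) → k), m₀ ≤ m ∧ n ≤ r ∧
      (∀ i, a i ∈ towerLevel E t m) ∧ (∀ i S, v i S ∈ towerLevel E t m) ∧
      AnisotropicOn Set.univ (pfisterWeight a) ∧
      (∀ i j, i ≠ j → ∑ S, pfisterWeight a S * (v i S * v j S) = 0) ∧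
      ∀ i, pfisterValue a (v i) = b i := by
  induction n with
  | zero =>
    refine ⟨m₀, 0, Fin.elim0, Fin.elim0, le_rfl, le_rfl, fun i => i.elim0, fun i => i.elim0, ?_,
      fun i => i.elim0, fun i => i.elim0⟩
    intro x _ hx
    have h0 : (default : Finset (Fin 0)) = ∅ := rfl
    funext S
    rw [Finset.univ_unique, Finset.sum_singleton, h0, pfisterWeight_empty, one_mul] at hx
    rw [Subsingleton.elim S ∅]
    exact pow_eq_zero_iff two_ne_zero |>.1 hx
  | succ n ih =>
    obtain ⟨e, b, rfl⟩ : ∃ (e : k) (b' : Fin n → k), b = Fin.cons e b' :=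
      ⟨b 0, Fin.tail b, (Fin.cons_self_tail b).symm⟩
    have hb' : AnisotropicOn Set.univ b := hb.comp_injective (Fin.succ_injective n)
    obtain ⟨m, r, a, v, hm, hr, ha, hv, han, hvo, hvb⟩ := ih hb' fun i => hbm i.succ
    have he : e ∈ towerLevel E t m := towerLevel_mono hm (hbm 0)
    have hv0 : ∀ i, v i ≠ 0 := by
      intro i hi
      exact hb'.ne_zero i (by rw [← hvb, hi]; simp [pfisterValue])
    obtain ⟨s, w, c, hwm, hcm, hwv, hw, hcw, hwc⟩ : ∃ (s : ℕ)
        (w : Fin n ⊕ Fin s → Finset (Fin r) → k) (c : Finset (Fin r) → Fin n ⊕ Fin s → k),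
        (∀ j S, w j S ∈ towerLevel E t m) ∧ (∀ S j, c S j ∈ towerLevel E t m) ∧
        (∀ i, w (Sum.inl i) = v i) ∧
        (∀ i j, i ≠ j → ∑ S, pfisterWeight a S * (w i S * w j S) = 0) ∧
        (∀ S T, ∑ j, c S j * w j T = if S = T then 1 else 0) ∧
        (∀ i j, ∑ S, w i S * c S j = if i = j then 1 else 0) := by
      clear hvb
      lift a to Fin r → towerLevel E t m using ha
      have hwt : ∀ S,
          pfisterWeight (fun i => (a i : k)) S = (pfisterWeight a S : towerLevel E t m) :=
        fun S => (map_pfisterWeight (algebraMap (towerLevel E t m) k) a S).symm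
      lift v to Fin n → Finset (Fin r) → towerLevel E t m using hv
      have hp : AnisotropicOn Set.univ (pfisterWeight a) := by
        rw [← anisotropicOn_intermediateField_iff]
        simp_rw [← hwt]
        exact han.mono (Set.subset_univ _)
      have hvo' : ∀ i j, i ≠ j → ∑ S, pfisterWeight a S * (v i S * v j S) = 0 := by
        intro i j hij
        have := hvo i j hij
        simp_rw [hwt] at this
        exact Subtype.ext (by simpa using this)
      have hv0' : ∀ i, v i ≠ 0 := by
        intro i hi
        exact hv0 i (by simp [hi]; rfl)
      obtain ⟨s, w, c, h1, h2, h3, h4⟩ := hp.exists_diagonalization_extending hvo' hv0'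
      refine ⟨s, fun j S => w j S, fun S j => c S j, fun j S => (w j S).2, fun S j => (c S j).2,
        fun i => ?_, fun i j hij => ?_, fun S T => ?_, fun i j => ?_⟩
      · simp [h1]
      · simpa [hwt] using congrArg (algebraMap (towerLevel E t m) k) (h2 i j hij)
      · simpa [apply_ite] using congrArg (algebraMap (towerLevel E t m) k) (h3 S T)
      · simpa [apply_ite] using congrArg (algebraMap (towerLevel E t m) k) (h4 i j)
    have hle : towerLevel E t m ≤ towerLevel E t (m + s) := towerLevel_mono (Nat.le_add_right _ _)
    have htm : ∀ j : Fin s, t (m + j) ∈ towerLevel E t (m + s) := fun j =>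
      mem_towerLevel (Nat.add_lt_add_left j.2 m)
    have hval : ∀ j, pfisterValue a (w j) ∈ towerLevel E t m := fun j =>
      sum_mem fun S _ => mul_mem (prod_mem fun i _ => neg_mem (ha i)) (pow_mem (hwm j S) 2)
    refine ⟨m + s, r + 1, Fin.cons
      (∑ j : Fin s, pfisterValue a (w (Sum.inr j)) * t (m + j) ^ 2 - e) a,
      Fin.cons (pfisterPair (fun S => ∑ j : Fin s, t (m + j) * w (Sum.inr j) S) (Pi.single ∅ 1))
        (fun i => pfisterPair (v i) 0), hm.trans (Nat.le_add_right _ _), Nat.succ_le_succ hr,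
      ?_, ?_,
      AnisotropicOn.pfisterWeight_cons_generic ht htop ha han he hb hwm hcm
        (fun i => by rw [hwv, hvb]) hw hcw hwc, ?_, ?_⟩
    · refine Fin.cases ?_ fun i => hle (ha i)
      exact sub_mem (sum_mem fun j _ => mul_mem (hle (hval _)) (pow_mem (htm j) 2)) (hle he)
    · refine Fin.cases (fun T => ?_) fun i => pfisterPair_mem
        (F := (towerLevel E t (m + s) : Set k)) (fun S => hle (hv i S)) fun S => zero_mem _
      refine pfisterPair_mem (F := (towerLevel E t (m + s) : Set k))
        (fun S => sum_mem fun j _ => mul_mem (htm j) (hle (hwm _ S))) (fun S => ?_) T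
      rw [Pi.single_apply]
      split_ifs
      exacts [one_mem _, zero_mem _]
    · have key : ∀ i, ∑ S, pfisterWeight a S *
          (v i S * ∑ j : Fin s, t (m + j) * w (Sum.inr j) S) = 0 := by
        intro i
        calc _ = ∑ j : Fin s, t (m + j) *
              ∑ S, pfisterWeight a S * (w (Sum.inl i) S * w (Sum.inr j) S) := by
              simp only [Finset.mul_sum, hwv]
              rw [Finset.sum_comm]
              exact Finset.sum_congr rfl fun S _ => Finset.sum_congr rfl fun j _ => by ring
          _ = 0 := Finset.sum_eq_zero fun j _ => by rw [hw _ _ Sum.inl_ne_inr, mul_zero]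
      refine Fin.cases (Fin.cases (fun h => absurd rfl h) fun j _ => ?_)
        fun i => Fin.cases (fun _ => ?_) fun j hij => ?_
      · rw [Fin.cons_zero, Fin.cons_succ, sum_pfisterWeight_cons_mul_pfisterPair]
        simpa [mul_comm] using key j
      · rw [Fin.cons_zero, Fin.cons_succ, sum_pfisterWeight_cons_mul_pfisterPair]
        simpa using key i
      · rw [Fin.cons_succ, Fin.cons_succ, sum_pfisterWeight_cons_mul_pfisterPair]
        simpa using hvo i j fun h => hij (by rw [h])
    · refine Fin.cases ?_ fun i => ?_
      on_goal 2 =>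
        rw [Fin.cons_succ, Fin.cons_succ, pfisterValue_cons_pfisterPair, hvb]
        simp [pfisterValue]
      rw [Fin.cons_zero, Fin.cons_zero, pfisterValue_cons_pfisterPair]
      have h1 : pfisterValue a (Pi.single ∅ 1) = 1 := by
        rw [pfisterValue, Finset.sum_eq_single ∅ (fun S _ hS => by simp [hS]) (by simp)]
        simp
      have h2 : pfisterValue a (fun S => ∑ j : Fin s, t (m + j) * w (Sum.inr j) S)
          = ∑ j : Fin s, pfisterValue a (w (Sum.inr j)) * t (m + j) ^ 2 :=
        sum_mul_sq_sum_eq (w := fun j => w (Sum.inr j))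
          (fun i j hij => hw _ _ fun h => hij (Sum.inr_injective h)) _
      rw [h1, h2]
      ring

end Induction

section Flexible

open IntermediateField QuadraticMap

theorem IsFlexible.exists_algebraicIndependent {k : Type u} [Field k] (hk : IsFlexible k) :
    ∃ (E : Type u) (_ : Field E) (_ : Algebra E k) (t : ℕ → k),
      AlgebraicIndependent E t ∧ adjoin E (Set.range t) = ⊤ := by
  obtain ⟨⟨E, φ⟩⟩ := hk
  let ψ : MvPolynomial ℕ E →+* k := φ.symm.toRingHom.comp (algebraMap _ _)
  have hψ : Function.Injective ψ := φ.symm.injective.comp (IsFractionRing.injective _ _)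
  let _ : Algebra E k := (ψ.comp MvPolynomial.C).toAlgebra
  let t : ℕ → k := fun i => ψ (MvPolynomial.X i)
  have haeval : ∀ p, MvPolynomial.aeval t p = ψ p := by
    intro p
    induction p using MvPolynomial.induction_on with
    | C c => simp; rfl
    | add p q hp hq => rw [map_add, map_add, hp, hq]
    | mul_X p i hp => rw [map_mul, map_mul, hp, MvPolynomial.aeval_X]
  refine ⟨E, inferInstance, inferInstance, t, ?_, ?_⟩
  · intro p q h
    rw [haeval, haeval] at h
    exact hψ h
  · rw [eq_top_iff]
    intro x _
    have hmem : ∀ p, ψ p ∈ adjoin E (Set.range t) := fun p => by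
      rw [← haeval]
      have hp : MvPolynomial.aeval t p ∈ (MvPolynomial.aeval (R := E) t).range := ⟨p, rfl⟩
      rw [MvPolynomial.aeval_range] at hp
      exact algebra_adjoin_le_adjoin _ _ hp
    obtain ⟨p, q, -, hpq⟩ := IsFractionRing.div_surjective (A := MvPolynomial ℕ E) (φ x)
    have : x = ψ p / ψ q := by
      rw [← φ.symm_apply_apply x, ← hpq, map_div₀]
      rfl
    rw [this]
    exact div_mem (hmem p) (hmem q)

theorem equivalent_weightedSumSquares_sum {K ι κ : Type*} [Field K] [Fintype ι] [Fintype κ]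
    (d : ι ⊕ κ → K) :
    (weightedSumSquares K d).Equivalent ((weightedSumSquares K (d ∘ Sum.inl)).prod
      (weightedSumSquares K (d ∘ Sum.inr))) :=
  ⟨{ LinearEquiv.sumArrowLequivProdArrow ι κ K K with
    map_app' := fun x => by
      simp [weightedSumSquares_apply, Fintype.sum_sum_type] }⟩

end Flexible

/-- Over a flexible field of characteristic zero, every nonzero anisotropic quadratic form is,
up to a scalar multiple, a subform of an anisotropic Pfister form defined over `k` itself. -/
theorem subform_of_anisotropic_pfister_of_flexible
    {k : Type u} [Field k] [CharZero k] (hk : IsFlexible k)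
    {V : Type u} [AddCommGroup V] [Module k V] [FiniteDimensional k V]
    (q : QuadraticForm k V) (hq0 : q ≠ 0) (hqa : QuadraticMap.Anisotropic q) :
    ∃ (r : ℕ) (a : Fin r → k) (c : k) (d : ℕ) (q' : QuadraticForm k (Fin d → k)),
      1 ≤ r ∧ (∀ i, a i ≠ 0) ∧ c ≠ 0 ∧
      QuadraticMap.Anisotropic (PfisterForm k a) ∧
      Nonempty (QuadraticMap.IsometryEquiv (PfisterForm k a)
        (QuadraticMap.prod (c • q) q')) := by
  obtain ⟨E, _, _, t, ht, htop⟩ := hk.exists_algebraicIndependent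
  obtain ⟨b, ⟨f⟩⟩ := QuadraticForm.equivalent_weightedSumSquares q
  have hn : Module.finrank k V ≠ 0 := by
    intro h0
    have := Module.finrank_zero_iff.1 h0
    exact hq0 (by ext x; simp [Subsingleton.elim x 0])
  have hb : AnisotropicOn Set.univ b := by
    rw [← anisotropic_weightedSumSquares_iff]
    intro x hx
    rw [← f.symm.map_app] at hx
    exact f.symm.toLinearEquiv.map_eq_zero_iff.1 (hqa _ hx)
  obtain ⟨m, -, hbm⟩ := exists_forall_mem_towerLevel htop 0 b
  obtain ⟨-, r, a, v, -, hr, -, -, han, hvo, hvb⟩ := hb.exists_pfister ht htop hbm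
  have hQ : (PfisterForm k a).Anisotropic := anisotropic_weightedSumSquares_iff.2 han
  have hval : ∀ u, PfisterForm k a u = pfisterValue a u := fun u => by
    simp [PfisterForm, pfisterValue, pfisterWeight, QuadraticMap.weightedSumSquares_apply, pow_two]
  have hv0 : ∀ i, v i ≠ 0 := by
    intro i hi
    exact hb.ne_zero i (by rw [← hvb, hi]; simp [pfisterValue])
  obtain ⟨d, B, hBv, hB⟩ := hQ.exists_isOrtho_basis_extending (v := v) (fun i j hij =>
    (associated_weightedSumSquares_apply (pfisterWeight a) (v i) (v j)).trans (hvo i j hij)) hv0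
  obtain ⟨g⟩ := ((PfisterForm k a).equivalent_weightedSumSquares_of_isOrtho B hB).trans
    (equivalent_weightedSumSquares_sum _)
  have hBb : (fun i => PfisterForm k a (B i)) ∘ Sum.inl = b := by
    funext i
    rw [Function.comp_apply, hBv, hval, hvb]
  rw [hBb] at g
  refine ⟨r, a, 1, d, QuadraticMap.weightedSumSquares k (fun j => PfisterForm k a (B (Sum.inr j))),
    (Nat.one_le_iff_ne_zero.2 hn).trans hr, fun i hi => ?_, one_ne_zero, hQ, ?_⟩
  · exact han.ne_zero {i} (by simp [pfisterWeight, hi])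
  · rw [one_smul]
    exact ⟨g.trans (QuadraticMap.IsometryEquiv.prod f.symm (QuadraticMap.IsometryEquiv.refl _))⟩
end
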